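/- arXiv:2210.01376 — 2 statements merged into one kernel-verified Lean document; each statement's English description precedes it below -/
import Mathlib

section
/- There exists a universal constant C such that the following holds. Under the strongly observable graph algorithm with η ≤ 1/2, β ≤ 1/2 and γ ∈ (0,1/2], fix any arm j ∈ [K] and define Term5 = Σ_{t=1}^T ⟨p_t − e_j, ℓ_t − ℓ̂_t⟩_{S_t}, where ⟨x,y⟩_U = Σ_{i∈U} x_i y_i, and Q_t = Σ_{i∈S_t} p_{t,i}/(W_{t,i}+γ). Then for every δ ∈ (0,1), with probability at least 1 − 2δ, Term5 ≤ C · log(KT/(γδ)) · ( √(Σ_{t=1}^T Q_t · log(1/δ)) + (max_{t∈[T]} Q_t) · log(1/δ) + γ Σ_{t=1}^T Q_t + (1/γ) · log(K/δ) ). -/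
open MeasureTheory

/-- The estimation error `⟨p - e_j, ℓ - ℓ̂⟩_S` of the implicit-exploration estimator on the
self-loop nodes of the graph with in-neighbourhoods `N`, when action `a` is drawn from `q`. -/
noncomputable def estimationError {K : ℕ} (γ : ℝ) (N : Fin K → Finset (Fin K))
    (q p ℓ : Fin K → ℝ) (j a : Fin K) : ℝ :=
  ∑ i with i ∈ N i, (p i - if i = j then (1 : ℝ) else 0) *
    (ℓ i - if a ∈ N i then ℓ i / (∑ k ∈ N i, q k + γ) else 0)

/-- The variance proxy `Q = ∑_{i ∈ S} p_i / (W_i + γ)`. -/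
noncomputable def varianceProxy {K : ℕ} (γ : ℝ) (N : Fin K → Finset (Fin K))
    (q p : Fin K → ℝ) : ℝ :=
  ∑ i with i ∈ N i, p i / (∑ k ∈ N i, q k + γ)

theorem exp_le_one_add_add_sq {x : ℝ} (hx : x ≤ 1) : Real.exp x ≤ 1 + x + x ^ 2 := by
  rcases le_or_gt (-1) x with h | h
  · have := Real.abs_exp_sub_one_sub_id_le (abs_le.2 ⟨h, hx⟩)
    linarith [(abs_le.1 this).2]
  · have : Real.exp x ≤ 1 := Real.exp_le_one_iff.2 (by linarith)
    nlinarith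

theorem estimationError_eq {K : ℕ} (γ : ℝ) (N : Fin K → Finset (Fin K))
    (q p ℓ : Fin K → ℝ) (j a : Fin K) :
    estimationError γ N q p ℓ j a =
      (∑ i with i ∈ N i, p i * ℓ i) - (if j ∈ N j then ℓ j else 0)
      + (if j ∈ N j then (if a ∈ N j then ℓ j / (∑ k ∈ N j, q k + γ) else 0) else 0)
      - ∑ i with i ∈ N i, p i * (if a ∈ N i then ℓ i / (∑ k ∈ N i, q k + γ) else 0) := by
  have h : ∀ f : Fin K → ℝ,
      ∑ i with i ∈ N i, (if i = j then (1 : ℝ) else 0) * f i = if j ∈ N j then f j else 0 := by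
    intro f
    simp [Finset.sum_ite_eq']
  rw [← h ℓ, ← h fun i => if a ∈ N i then ℓ i / (∑ k ∈ N i, q k + γ) else 0,
    ← Finset.sum_sub_distrib, ← Finset.sum_add_distrib, ← Finset.sum_sub_distrib]
  exact Finset.sum_congr rfl fun i _ => by ring

section Round

variable {K : ℕ} {γ : ℝ} {N : Fin K → Finset (Fin K)} {q p ℓ : Fin K → ℝ}

theorem varianceProxy_nonneg (hγ : 0 < γ) (hq : ∀ i, 0 ≤ q i) (hp : ∀ i, 0 ≤ p i) :
    0 ≤ varianceProxy γ N q p :=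
  Finset.sum_nonneg fun i _ => div_nonneg (hp i)
    (add_nonneg (Finset.sum_nonneg fun k _ => hq k) hγ.le)

theorem sum_filter_mul_le_one (s : Finset (Fin K)) (hp : ∀ i, 0 ≤ p i) (hps : ∑ i, p i = 1)
    (hℓ : ∀ i, ℓ i ∈ Set.Icc (0 : ℝ) 1) : ∑ i ∈ s, p i * ℓ i ≤ 1 := by
  calc ∑ i ∈ s, p i * ℓ i ≤ ∑ i ∈ s, p i :=
        Finset.sum_le_sum fun i _ => mul_le_of_le_one_right (hp i) (hℓ i).2
    _ ≤ ∑ i, p i := Finset.sum_le_univ_sum_of_nonneg hp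
    _ = 1 := hps

theorem loss_div_mem (hγ : 0 < γ) (hq : ∀ i, 0 ≤ q i)
    (hℓ : ∀ i, ℓ i ∈ Set.Icc (0 : ℝ) 1) (a i : Fin K) :
    (if a ∈ N i then ℓ i / (∑ k ∈ N i, q k + γ) else 0) ∈ Set.Icc (0 : ℝ) (1 / γ) := by
  have hW : 0 ≤ ∑ k ∈ N i, q k := Finset.sum_nonneg fun k _ => hq k
  split_ifs
  · exact ⟨div_nonneg (hℓ i).1 (by linarith),
      div_le_div₀ zero_le_one (hℓ i).2 hγ (by linarith)⟩
  · exact ⟨le_rfl, by positivity⟩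

theorem mul_estimationError_sub_le (hγ : 0 < γ) (hγ1 : γ ≤ 1)
    (hq : ∀ i, 0 ≤ q i) (hp : ∀ i, 0 ≤ p i) (hps : ∑ i, p i = 1)
    (hℓ : ∀ i, ℓ i ∈ Set.Icc (0 : ℝ) 1) (j a : Fin K) :
    γ * (estimationError γ N q p ℓ j a - 2 * γ * varianceProxy γ N q p) ≤ 2 := by
  rw [estimationError_eq]
  have hQ := varianceProxy_nonneg (N := N) hγ hq hp
  have hm := sum_filter_mul_le_one {i | i ∈ N i} hp hps hℓ
  have hl : 0 ≤ if j ∈ N j then ℓ j else 0 := by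
    split_ifs
    exacts [(hℓ j).1, le_rfl]
  have hY : (if j ∈ N j then (if a ∈ N j then ℓ j / (∑ k ∈ N j, q k + γ) else 0) else 0)
      ≤ 1 / γ := by
    by_cases hj : j ∈ N j
    · rw [if_pos hj]
      exact (loss_div_mem hγ hq hℓ a j).2
    · rw [if_neg hj]
      positivity
  have hZ : 0 ≤ ∑ i with i ∈ N i,
      p i * (if a ∈ N i then ℓ i / (∑ k ∈ N i, q k + γ) else 0) :=
    Finset.sum_nonneg fun i _ => mul_nonneg (hp i) (loss_div_mem hγ hq hℓ a i).1
  have hγγ : γ * (1 / γ) = 1 := by field_simp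
  calc _ ≤ γ * (1 + 1 / γ) := by
        apply mul_le_mul_of_nonneg_left _ hγ.le
        have : 0 ≤ 2 * γ * varianceProxy γ N q p := by positivity
        linarith
    _ ≤ 2 := by rw [mul_add, hγγ]; linarith

theorem sum_mul_exp_estimationError_le_one (hγ : 0 < γ)
    (hq : ∀ i, 0 ≤ q i) (hqs : ∑ i, q i = 1) (hp : ∀ i, 0 ≤ p i) (hps : ∑ i, p i = 1)
    (hℓ : ∀ i, ℓ i ∈ Set.Icc (0 : ℝ) 1) (j : Fin K) :
    ∑ a, q a * Real.exp
      (γ * (estimationError γ N q p ℓ j a - 2 * γ * varianceProxy γ N q p)) ≤ 1 := by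
  simp_rw [estimationError_eq]
  set Q := varianceProxy γ N q p
  set m := ∑ i with i ∈ N i, p i * ℓ i with hm
  set l := if j ∈ N j then ℓ j else 0 with hl
  set c : Fin K → Fin K → ℝ :=
    fun a i => if a ∈ N i then ℓ i / (∑ k ∈ N i, q k + γ) else 0 with hc
  set Y : Fin K → ℝ := fun a => if j ∈ N j then c a j else 0 with hY
  set Z : Fin K → ℝ := fun a => ∑ i with i ∈ N i, p i * c a i with hZ
  have hcmem : ∀ a i, c a i ∈ Set.Icc (0 : ℝ) (1 / γ) := loss_div_mem hγ hq hℓ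
  have hQ0 : 0 ≤ Q := varianceProxy_nonneg hγ hq hp
  have hm1 : m ≤ 1 := sum_filter_mul_le_one _ hp hps hℓ
  have hW : ∀ i, 0 ≤ ∑ k ∈ N i, q k := fun i => Finset.sum_nonneg fun k _ => hq k
  have hZ0 : ∀ a, 0 ≤ Z a := fun a =>
    Finset.sum_nonneg fun i _ => mul_nonneg (hp i) (hcmem a i).1
  have hY0 : ∀ a, 0 ≤ Y a := fun a => by
    simp only [hY]; split_ifs; exacts [(hcmem a j).1, le_rfl]
  have hY1 : ∀ a, γ * Y a ≤ 1 := fun a => by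
    rw [← le_div_iff₀' hγ]
    simp only [hY]; split_ifs; exacts [(hcmem a j).2, by positivity]
  have hZQ : ∀ a, Z a ≤ Q := fun a => by
    refine Finset.sum_le_sum fun i _ => ?_
    rw [div_eq_mul_one_div]
    refine mul_le_mul_of_nonneg_left ?_ (hp i)
    have := hW i
    simp only [hc]
    split_ifs
    · exact div_le_div_of_nonneg_right (hℓ i).2 (by linarith)
    · exact div_nonneg zero_le_one (by linarith)
  have hqc : ∀ i, ∑ a, q a * c a i = ℓ i - γ * (ℓ i / (∑ k ∈ N i, q k + γ)) := fun i => by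
    have hpos : 0 < ∑ k ∈ N i, q k + γ := by linarith [hW i]
    simp only [hc, mul_ite, mul_zero, Finset.sum_ite_mem, Finset.univ_inter]
    rw [← Finset.sum_mul]
    field_simp
    ring
  have hEZ : ∑ a, q a * Z a = m - γ * ∑ i with i ∈ N i,
      p i * (ℓ i / (∑ k ∈ N i, q k + γ)) := by
    simp only [hZ, Finset.mul_sum]
    rw [Finset.sum_comm, hm, ← Finset.sum_sub_distrib]
    refine Finset.sum_congr rfl fun i _ => ?_
    calc ∑ a, q a * (p i * c a i) = p i * ∑ a, q a * c a i := by
          rw [Finset.mul_sum]; exact Finset.sum_congr rfl fun a _ => by ring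
      _ = _ := by rw [hqc]; ring
  have hbias0 : 0 ≤ ∑ i with i ∈ N i, p i * (ℓ i / (∑ k ∈ N i, q k + γ)) :=
    Finset.sum_nonneg fun i _ => mul_nonneg (hp i)
      (div_nonneg (hℓ i).1 (by linarith [hW i]))
  have hbias : ∑ i with i ∈ N i, p i * (ℓ i / (∑ k ∈ N i, q k + γ)) ≤ Q := by
    refine Finset.sum_le_sum fun i _ => ?_
    rw [div_eq_mul_one_div (p i)]
    exact mul_le_mul_of_nonneg_left
      (div_le_div_of_nonneg_right (hℓ i).2 (by linarith [hW i])) (hp i)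
  have hEZ_ge : m - γ * Q ≤ ∑ a, q a * Z a := by
    rw [hEZ]; nlinarith
  have hEZ2 : ∑ a, q a * Z a ^ 2 ≤ Q := by
    calc ∑ a, q a * Z a ^ 2 ≤ ∑ a, Q * (q a * Z a) :=
          Finset.sum_le_sum fun a _ => by
            have := mul_le_mul_of_nonneg_left (hZQ a) (mul_nonneg (hq a) (hZ0 a))
            nlinarith
      _ = Q * ∑ a, q a * Z a := by rw [Finset.mul_sum]
      _ ≤ Q := mul_le_of_le_one_right hQ0 (by rw [hEZ]; nlinarith)
  have hEY : ∑ a, q a * Y a + γ * ∑ a, q a * Y a ^ 2 ≤ l := by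
    by_cases hj : j ∈ N j
    · have hd0 : 0 ≤ ℓ j / (∑ k ∈ N j, q k + γ) :=
        div_nonneg (hℓ j).1 (by linarith [hW j])
      have hsq : ∑ a, q a * c a j ^ 2 =
          (ℓ j / (∑ k ∈ N j, q k + γ)) * ∑ a, q a * c a j := by
        rw [Finset.mul_sum]
        refine Finset.sum_congr rfl fun a _ => ?_
        simp only [hc]
        split_ifs <;> ring
      simp only [hY, hl, hj, if_true]
      rw [hsq, hqc]
      have h1 : ℓ j - γ * (ℓ j / (∑ k ∈ N j, q k + γ)) ≤ 1 := by
        nlinarith [(hℓ j).2]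
      nlinarith [mul_le_mul_of_nonneg_left h1 (mul_nonneg hγ.le hd0)]
    · simp [hY, hl, hj]
  have hexp : ∀ a, Real.exp (γ * (m - l + Y a - Z a - 2 * γ * Q)) ≤
      Real.exp (-(γ * (l - m + 2 * γ * Q))) *
        (1 + γ * (Y a - Z a) + γ ^ 2 * (Y a ^ 2 + Z a ^ 2)) := fun a => by
    rw [show γ * (m - l + Y a - Z a - 2 * γ * Q) =
      -(γ * (l - m + 2 * γ * Q)) + γ * (Y a - Z a) by ring, Real.exp_add]
    refine mul_le_mul_of_nonneg_left ?_ (Real.exp_nonneg _)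
    refine (exp_le_one_add_add_sq ?_).trans ?_
    · nlinarith [hY1 a, mul_nonneg hγ.le (hZ0 a)]
    · nlinarith [mul_nonneg (sq_nonneg γ) (mul_nonneg (hY0 a) (hZ0 a))]
  calc ∑ a, q a * Real.exp (γ * (m - l + Y a - Z a - 2 * γ * Q))
      ≤ ∑ a, q a * (Real.exp (-(γ * (l - m + 2 * γ * Q))) *
        (1 + γ * (Y a - Z a) + γ ^ 2 * (Y a ^ 2 + Z a ^ 2))) :=
        Finset.sum_le_sum fun a _ => mul_le_mul_of_nonneg_left (hexp a) (hq a)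
    _ = Real.exp (-(γ * (l - m + 2 * γ * Q))) * ((∑ a, q a) +
        γ * (∑ a, q a * Y a + γ * ∑ a, q a * Y a ^ 2) - γ * ∑ a, q a * Z a +
        γ ^ 2 * ∑ a, q a * Z a ^ 2) := by
        simp only [Finset.mul_sum, mul_add, mul_sub, ← Finset.sum_add_distrib,
          ← Finset.sum_sub_distrib]
        exact Finset.sum_congr rfl fun a _ => by ring
    _ ≤ Real.exp (-(γ * (l - m + 2 * γ * Q))) * (γ * (l - m + 2 * γ * Q) + 1) := by
        refine mul_le_mul_of_nonneg_left ?_ (Real.exp_nonneg _)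
        rw [hqs]
        nlinarith [mul_le_mul_of_nonneg_left hEY hγ.le,
          mul_le_mul_of_nonneg_left hEZ_ge hγ.le,
          mul_le_mul_of_nonneg_left hEZ2 (sq_nonneg γ)]
    _ ≤ Real.exp (-(γ * (l - m + 2 * γ * Q))) * Real.exp (γ * (l - m + 2 * γ * Q)) :=
        mul_le_mul_of_nonneg_left (Real.add_one_le_exp _) (Real.exp_nonneg _)
    _ = 1 := by rw [← Real.exp_add]; simp

end Round

section Measurability

variable {Ω : Type*} [MeasurableSpace Ω] {K : ℕ} {N : Ω → Fin K → Finset (Fin K)}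
  {q p ℓ : Ω → Fin K → ℝ}

theorem measurable_sum_mem_add (γ : ℝ) (hN : ∀ i k, MeasurableSet {ω | k ∈ N ω i})
    (hq : ∀ i, Measurable fun ω => q ω i) (i : Fin K) :
    Measurable fun ω => ∑ k ∈ N ω i, q ω k + γ := by
  have : (fun ω => ∑ k ∈ N ω i, q ω k + γ) =
      fun ω => (∑ k, if k ∈ N ω i then q ω k else 0) + γ := by
    funext ω; simp
  rw [this]
  exact (Finset.measurable_fun_sum _ fun k _ =>
    Measurable.ite (hN i k) (hq k) measurable_const).add_const γ

theorem measurable_varianceProxy (γ : ℝ) (hN : ∀ i k, MeasurableSet {ω | k ∈ N ω i})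
    (hq : ∀ i, Measurable fun ω => q ω i) (hp : ∀ i, Measurable fun ω => p ω i) :
    Measurable fun ω => varianceProxy γ (N ω) (q ω) (p ω) := by
  simp only [varianceProxy, Finset.sum_filter]
  exact Finset.measurable_fun_sum _ fun i _ => Measurable.ite (hN i i)
    ((hp i).div (measurable_sum_mem_add γ hN hq i)) measurable_const

theorem measurable_estimationError (γ : ℝ) (hN : ∀ i k, MeasurableSet {ω | k ∈ N ω i})
    (hq : ∀ i, Measurable fun ω => q ω i) (hp : ∀ i, Measurable fun ω => p ω i)
    (hℓ : ∀ i, Measurable fun ω => ℓ ω i) (j a : Fin K) :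
    Measurable fun ω => estimationError γ (N ω) (q ω) (p ω) (ℓ ω) j a := by
  simp only [estimationError, Finset.sum_filter]
  exact Finset.measurable_fun_sum _ fun i _ => Measurable.ite (hN i i)
    (((hp i).sub_const _).mul ((hℓ i).sub (Measurable.ite (hN i a)
      ((hℓ i).div (measurable_sum_mem_add γ hN hq i)) measurable_const))) measurable_const

theorem measurable_eval_of_finite {α : Type*} [Fintype α] [MeasurableSpace α]
    [MeasurableSingletonClass α] {I : Ω → α} (hI : Measurable I) {g : α → Ω → ℝ}
    (hg : ∀ a, Measurable (g a)) : Measurable fun ω => g (I ω) ω := by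
  classical
  have : (fun ω => g (I ω) ω) = fun ω => ∑ a, if I ω = a then g a ω else 0 := by
    funext ω; simp
  rw [this]
  exact Finset.measurable_fun_sum _ fun a _ =>
    Measurable.ite (hI (measurableSet_singleton a)) (hg a) measurable_const

end Measurability

/-- If the conditional law of a finitely valued `I` given `m` is `q`, then `∫ g (I ω) ω` may be
computed by averaging the `m`-measurable functions `g a` against `q`. -/
theorem integral_eval_eq_integral_sum {Ω α : Type*} [Fintype α] [MeasurableSpace α]
    [MeasurableSingletonClass α] {m mΩ : MeasurableSpace Ω} (hm : m ≤ mΩ) {μ : Measure Ω}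
    [IsProbabilityMeasure μ] {I : Ω → α} (hI : Measurable I) {q : Ω → α → ℝ}
    (hlaw : ∀ a, μ[fun ω => Set.indicator {ω' | I ω' = a} (fun _ => (1 : ℝ)) ω | m]
      =ᵐ[μ] fun ω => q ω a)
    {g : α → Ω → ℝ} (hg : ∀ a, Measurable[m] (g a)) {B : ℝ} (hB : ∀ a ω, ‖g a ω‖ ≤ B) :
    Integrable (fun ω => ∑ a, q ω a * g a ω) μ ∧
      ∫ ω, g (I ω) ω ∂μ = ∫ ω, ∑ a, q ω a * g a ω ∂μ := by
  classical
  set χ : α → Ω → ℝ := fun a ω => Set.indicator {ω' | I ω' = a} (fun _ => (1 : ℝ)) ω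
  have hχ : ∀ a, Integrable (χ a) μ := fun a =>
    (integrable_const (1 : ℝ)).indicator (hI (measurableSet_singleton a))
  have hgχ : ∀ a, Integrable (fun ω => χ a ω * g a ω) μ := fun a =>
    (hχ a).mul_bdd (c := B) ((hg a).mono hm le_rfl).aestronglyMeasurable
      (Filter.Eventually.of_forall (hB a))
  have hce : ∀ a, μ[fun ω => χ a ω * g a ω | m] =ᵐ[μ] fun ω => q ω a * g a ω := fun a => by
    refine (condExp_mul_of_stronglyMeasurable_right (hg a).stronglyMeasurable
      (hgχ a) (hχ a)).trans ?_
    filter_upwards [hlaw a] with ω hω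
    simp only [Pi.mul_apply]
    rw [← hω]
  have hint : ∀ a, Integrable (fun ω => q ω a * g a ω) μ := fun a =>
    integrable_condExp.congr (hce a)
  refine ⟨integrable_finsetSum _ fun a _ => hint a, ?_⟩
  calc ∫ ω, g (I ω) ω ∂μ = ∫ ω, ∑ a, χ a ω * g a ω ∂μ := by
        congr 1; funext ω; simp [χ, Set.indicator_apply]
    _ = ∑ a, ∫ ω, χ a ω * g a ω ∂μ := integral_finsetSum _ fun a _ => hgχ a
    _ = ∑ a, ∫ ω, q ω a * g a ω ∂μ := Finset.sum_congr rfl fun a _ => by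
        rw [← integral_condExp hm, integral_congr_ae (hce a)]
    _ = ∫ ω, ∑ a, q ω a * g a ω ∂μ := (integral_finsetSum _ fun a _ => hint a).symm

/-- Exponential supermartingale bound: if `E[exp (X_t (I_t)) ∣ ℱ_{t-1}] ≤ 1` for each round then
`E[exp (∑ X_t (I_t))] ≤ 1`. -/
theorem integral_exp_sum_le_one {Ω α : Type*} [Fintype α] [MeasurableSpace α]
    [MeasurableSingletonClass α] {mΩ : MeasurableSpace Ω} {μ : Measure Ω}
    [IsProbabilityMeasure μ] {ℱ : ℕ → MeasurableSpace Ω} (hle : ∀ t, ℱ t ≤ mΩ)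
    (hmono : Monotone ℱ) {T : ℕ} {I : ℕ → Ω → α}
    (hI : ∀ t, 1 ≤ t → t ≤ T → Measurable[ℱ t] (I t)) {q : ℕ → Ω → α → ℝ}
    (hlaw : ∀ t, 1 ≤ t → t ≤ T → ∀ a,
      μ[fun ω => Set.indicator {ω' | I t ω' = a} (fun _ => (1 : ℝ)) ω | ℱ (t - 1)]
        =ᵐ[μ] fun ω => q t ω a)
    {X : ℕ → α → Ω → ℝ} (hX : ∀ t, 1 ≤ t → t ≤ T → ∀ a, Measurable[ℱ (t - 1)] (X t a))
    {B : ℝ} (hB : ∀ t a ω, X t a ω ≤ B)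
    (hexp : ∀ t ω, ∑ a, q t ω a * Real.exp (X t a ω) ≤ 1) :
    ∀ n ≤ T, Measurable[ℱ n] (fun ω => ∑ t ∈ Finset.Icc 1 n, X t (I t ω) ω) ∧
      Integrable (fun ω => Real.exp (∑ t ∈ Finset.Icc 1 n, X t (I t ω) ω)) μ ∧
      ∫ ω, Real.exp (∑ t ∈ Finset.Icc 1 n, X t (I t ω) ω) ∂μ ≤ 1 := by
  have hbound : ∀ n ω, ∑ t ∈ Finset.Icc 1 n, X t (I t ω) ω ≤ n * B := fun n ω => by
    calc _ ≤ ∑ t ∈ Finset.Icc 1 n, B := Finset.sum_le_sum fun t _ => hB t _ ω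
      _ = n * B := by simp
  have hmeas : ∀ n ≤ T, Measurable[ℱ n] (fun ω => ∑ t ∈ Finset.Icc 1 n, X t (I t ω) ω) :=
    fun n hn => by
      refine @Finset.measurable_fun_sum _ _ _ _ _ _ (ℱ n) _ _ fun t ht => ?_
      obtain ⟨h1, h2⟩ := Finset.mem_Icc.1 ht
      refine (@measurable_eval_of_finite Ω (ℱ t) α _ _ _ _ (hI t h1 (h2.trans hn)) _
        fun a => ?_).mono (hmono h2) le_rfl
      exact (hX t h1 (h2.trans hn) a).mono (hmono (Nat.sub_le t 1)) le_rfl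
  have hintg : ∀ n ≤ T,
      Integrable (fun ω => Real.exp (∑ t ∈ Finset.Icc 1 n, X t (I t ω) ω)) μ := fun n hn => by
    refine Integrable.of_bound (C := Real.exp (n * B))
      (Real.measurable_exp.comp ((hmeas n hn).mono (hle n) le_rfl)).aestronglyMeasurable
      (Filter.Eventually.of_forall fun ω => ?_)
    rw [Real.norm_eq_abs, Real.abs_exp]
    exact Real.exp_le_exp.2 (hbound n ω)
  intro n hn
  refine ⟨hmeas n hn, hintg n hn, ?_⟩
  induction n with
  | zero => simp
  | succ n ih =>
    have hn' : n ≤ T := (Nat.le_succ n).trans hn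
    set M : Ω → ℝ := fun ω => ∑ t ∈ Finset.Icc 1 n, X t (I t ω) ω with hM
    have hMm : Measurable[ℱ n] M := hmeas n hn'
    obtain ⟨hi, he⟩ := integral_eval_eq_integral_sum (hle n) (μ := μ)
      ((hI (n + 1) (Nat.le_add_left 1 n) hn).mono (hle _) le_rfl)
      (hlaw (n + 1) (Nat.le_add_left 1 n) hn)
      (g := fun a ω => Real.exp (M ω + X (n + 1) a ω))
      (fun a => Real.measurable_exp.comp
        (hMm.add (hX (n + 1) (Nat.le_add_left 1 n) hn a)))
      (B := Real.exp (n * B + B)) (fun a ω => by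
        rw [Real.norm_eq_abs, Real.abs_exp]
        exact Real.exp_le_exp.2 (add_le_add (hbound n ω) (hB _ a ω)))
    calc ∫ ω, Real.exp (∑ t ∈ Finset.Icc 1 (n + 1), X t (I t ω) ω) ∂μ
        = ∫ ω, Real.exp (M ω + X (n + 1) (I (n + 1) ω) ω) ∂μ := by
          simp only [Finset.sum_Icc_succ_top (Nat.le_add_left 1 n), hM]
      _ = ∫ ω, ∑ a, q (n + 1) ω a * Real.exp (M ω + X (n + 1) a ω) ∂μ := he
      _ ≤ ∫ ω, Real.exp (M ω) ∂μ := by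
          refine integral_mono hi (hintg n hn') fun ω => ?_
          calc ∑ a, q (n + 1) ω a * Real.exp (M ω + X (n + 1) a ω)
              = Real.exp (M ω) * ∑ a, q (n + 1) ω a * Real.exp (X (n + 1) a ω) := by
                rw [Finset.mul_sum]
                exact Finset.sum_congr rfl fun a _ => by rw [Real.exp_add]; ring
            _ ≤ Real.exp (M ω) := mul_le_of_le_one_right (Real.exp_nonneg _) (hexp _ ω)
      _ ≤ 1 := ih hn'

/-- Chernoff bound from `E[exp X] ≤ 1`. -/
theorem ofReal_one_sub_le_measure_le_log {Ω : Type*} [MeasurableSpace Ω] {μ : Measure Ω}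
    [IsProbabilityMeasure μ] {X : Ω → ℝ} (hX : Measurable X)
    (hint : Integrable (fun ω => Real.exp (X ω)) μ) (hle : ∫ ω, Real.exp (X ω) ∂μ ≤ 1)
    {δ : ℝ} (hδ : 0 < δ) :
    ENNReal.ofReal (1 - δ) ≤ μ {ω | X ω ≤ Real.log (1 / δ)} := by
  have hS : MeasurableSet {ω | X ω ≤ Real.log (1 / δ)} := measurableSet_le hX measurable_const
  have hmarkov := mul_meas_ge_le_integral_of_nonneg
    (Filter.Eventually.of_forall fun ω => Real.exp_nonneg (X ω)) hint (1 / δ)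
  have hcompl : μ.real {ω | X ω ≤ Real.log (1 / δ)}ᶜ ≤ δ := by
    calc μ.real {ω | X ω ≤ Real.log (1 / δ)}ᶜ ≤ μ.real {ω | 1 / δ ≤ Real.exp (X ω)} := by
          refine measureReal_mono fun ω hω => ?_
          have h : Real.log (1 / δ) < X ω := not_le.1 hω
          exact ((Real.log_lt_iff_lt_exp (by positivity)).1 h).le
      _ ≤ δ := by
          have := hmarkov.trans hle
          rwa [one_div_mul_eq_div, div_le_one hδ] at this
  rw [probReal_compl_eq_one_sub hS] at hcompl
  rw [← ofReal_measureReal]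
  exact ENNReal.ofReal_le_ofReal (by linarith)

/-- Bound on `Term5` (Lemma `term-5`): under the strongly observable graph algorithm with
`η ≤ 1/2`, `β ≤ 1/2`, `γ ∈ (0,1/2]`, for any fixed arm `j`, with
`Q_t = Σ_{i∈S_t} p_{t,i}/(W_{t,i}+γ)`, for a universal constant `C`, with probability at
least `1 − 2δ`,
`Σ_t ⟨p_t − e_j, ℓ_t − ℓ̂_t⟩_{S_t} ≤ C log(KT/(γδ)) (√(Σ_t Q_t log(1/δ)) +
(max_t Q_t) log(1/δ) + γ Σ_t Q_t + (1/γ) log(K/δ))`. -/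
theorem stmt_5 :
    ∃ C : ℝ, 0 < C ∧
    ∀ (Ω : Type) (mΩ : MeasurableSpace Ω) (μ : Measure Ω)
      (hμ : IsProbabilityMeasure μ)
      (ℱ : ℕ → MeasurableSpace Ω) (hℱle : ∀ t, ℱ t ≤ mΩ) (hℱmono : Monotone ℱ)
      (K T : ℕ) (hK : 2 ≤ K) (hT : 1 ≤ T)
      (ℓ : ℕ → Ω → Fin K → ℝ)
      (hℓmem : ∀ t ω i, ℓ t ω i ∈ Set.Icc (0 : ℝ) 1)
      (hℓmeas : ∀ t, 1 ≤ t → t ≤ T → ∀ i, Measurable[ℱ (t - 1)] fun ω => ℓ t ω i)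
      (Nin : ℕ → Ω → Fin K → Finset (Fin K))
      (hNmeas : ∀ t, 1 ≤ t → t ≤ T → ∀ i j,
        MeasurableSet[ℱ (t - 1)] {ω | j ∈ Nin t ω i})
      -- the graphs are strongly observable
      (hstrong : ∀ t, 1 ≤ t → t ≤ T → ∀ ω i,
        i ∈ Nin t ω i ∨ Nin t ω i = Finset.univ.erase i)
      -- parameters
      (η β γ : ℝ) (hη0 : 0 < η) (hηhalf : η ≤ 1 / 2)
      (hβ0 : 0 < β) (hβhalf : β ≤ 1 / 2) (hγ0 : 0 < γ) (hγhalf : γ ≤ 1 / 2)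
      -- the OMD iterates and the sampling distributions
      (p : ℕ → Ω → Fin K → ℝ)
      (hpmeas : ∀ t, 1 ≤ t → t ≤ T → ∀ i, Measurable[ℱ (t - 1)] fun ω => p t ω i)
      (hpnn : ∀ t ω i, 0 ≤ p t ω i) (hpsum : ∀ t ω, ∑ i, p t ω i = 1)
      (hp1 : ∀ ω i, p 1 ω i = 1 / K)
      (ptil : ℕ → Ω → Fin K → ℝ)
      (hptil : ∀ t ω i, ptil t ω i = (1 - η) * p t ω i + η / K)
      (I : ℕ → Ω → Fin K)
      (hImeas : ∀ t, 1 ≤ t → t ≤ T → Measurable[ℱ t] (I t))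
      (hIlaw : ∀ t, 1 ≤ t → t ≤ T → ∀ i,
        (μ[fun ω => Set.indicator {ω' | I t ω' = i} (fun _ => (1 : ℝ)) ω | ℱ (t - 1)])
          =ᵐ[μ] fun ω => ptil t ω i)
      (W : ℕ → Ω → Fin K → ℝ)
      (hW : ∀ t ω i, W t ω i = ∑ j ∈ Nin t ω i, ptil t ω j)
      -- implicit-exploration estimator on self-loop nodes, unbiased estimator otherwise
      (ℓhat : ℕ → Ω → Fin K → ℝ)
      (hℓhat : ∀ t ω i, ℓhat t ω i =
        if i ∈ Nin t ω i then
          (if I t ω ∈ Nin t ω i then ℓ t ω i / (W t ω i + γ) else 0)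
        else (if I t ω ≠ i then ℓ t ω i / W t ω i else 0))
      -- rounds in `𝒯` and the distinguished node `j_t`
      (inT : ℕ → Ω → Prop) (jt : ℕ → Ω → Fin K)
      (hinT : ∀ t ω, inT t ω ↔ ∃ j : Fin K, j ∉ Nin t ω j ∧ 1 / 2 < p t ω j)
      (hjt : ∀ t ω, inT t ω → jt t ω ∉ Nin t ω (jt t ω) ∧ 1 / 2 < p t ω (jt t ω))
      -- the positive bias vector
      (b : ℕ → Ω → Fin K → ℝ)
      (hb1 : ∀ t ω, inT t ω → b t ω (jt t ω) = β / W t ω (jt t ω))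
      (hb2 : ∀ t ω i, ¬inT t ω ∨ i ≠ jt t ω → b t ω i = 0)
      -- the OMD update with the entropy regularizer
      (Dψ : (Fin K → ℝ) → (Fin K → ℝ) → ℝ)
      (hD : ∀ x y, Dψ x y = (1 / η) * ∑ i, (x i * Real.log (x i / y i) + y i - x i))
      (hupdate : ∀ t, 1 ≤ t → t ≤ T → ∀ ω,
        (∀ i, 0 ≤ p (t + 1) ω i) ∧ (∑ i, p (t + 1) ω i = 1) ∧
          ∀ q : Fin K → ℝ, (∀ i, 0 ≤ q i) → (∑ i, q i = 1) →
            (∑ i, p (t + 1) ω i * (ℓhat t ω i + b t ω i)) + Dψ (p (t + 1) ω) (p t ω) ≤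
              (∑ i, q i * (ℓhat t ω i + b t ω i)) + Dψ q (p t ω))
      (j : Fin K)
      (Q : ℕ → Ω → ℝ)
      (hQ : ∀ t ω, Q t ω = ∑ i ∈ Finset.univ.filter (fun i => i ∈ Nin t ω i),
        p t ω i / (W t ω i + γ))
      (δ : ℝ) (hδ0 : 0 < δ) (hδ1 : δ < 1),
      ENNReal.ofReal (1 - 2 * δ) ≤
        μ {ω | ∑ t ∈ Finset.Icc 1 T,
            ∑ i ∈ Finset.univ.filter (fun i => i ∈ Nin t ω i),
              (p t ω i - (if i = j then (1 : ℝ) else 0)) * (ℓ t ω i - ℓhat t ω i) ≤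
          C * Real.log ((K : ℝ) * T / (γ * δ)) *
            (Real.sqrt ((∑ t ∈ Finset.Icc 1 T, Q t ω) * Real.log (1 / δ)) +
              ((Finset.Icc 1 T).sup' (Finset.nonempty_Icc.mpr hT) fun t => Q t ω) *
                Real.log (1 / δ) +
              γ * (∑ t ∈ Finset.Icc 1 T, Q t ω) +
              (1 / γ) * Real.log (K / δ))} := by
  refine ⟨2, two_pos, ?_⟩
  intro Ω mΩ μ hμ ℱ hℱle hℱmono K T hK hT ℓ hℓmem hℓmeas Nin hNmeas _ η β γ hη0 hηhalf _ _
    hγ0 hγhalf p hpmeas hpnn hpsum _ ptil hptil I hImeas hIlaw W hW ℓhat hℓhat _ _ _ _ _ _ _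
    _ _ _ j Q hQ δ hδ0 hδ1
  have hK0 : (0 : ℝ) < K := by exact_mod_cast (by omega : 0 < K)
  have hqnn : ∀ t ω i, 0 ≤ ptil t ω i := fun t ω i => by
    rw [hptil]
    exact add_nonneg (mul_nonneg (by linarith) (hpnn t ω i)) (by positivity)
  have hqsum : ∀ t ω, ∑ i, ptil t ω i = 1 := fun t ω => by
    simp only [hptil, Finset.sum_add_distrib, ← Finset.mul_sum, hpsum]
    simp
    field_simp
    ring
  have hqmeas : ∀ t, 1 ≤ t → t ≤ T → ∀ i, Measurable[ℱ (t - 1)] fun ω => ptil t ω i :=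
    fun t h1 h2 i => by
      simp only [hptil]
      exact ((hpmeas t h1 h2 i).const_mul _).add_const _
  have hQeq : ∀ t ω, Q t ω = varianceProxy γ (Nin t ω) (ptil t ω) (p t ω) := fun t ω => by
    simp only [hQ, hW, varianceProxy]
  have hQnn : ∀ t ω, 0 ≤ Q t ω := fun t ω => by
    rw [hQeq]; exact varianceProxy_nonneg hγ0 (hqnn t ω) (hpnn t ω)
  set X : ℕ → Fin K → Ω → ℝ := fun t a ω => γ *
    (estimationError γ (Nin t ω) (ptil t ω) (p t ω) (ℓ t ω) j a -
      2 * γ * varianceProxy γ (Nin t ω) (ptil t ω) (p t ω)) with hXdef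
  have hXmeas : ∀ t, 1 ≤ t → t ≤ T → ∀ a, Measurable[ℱ (t - 1)] (X t a) := fun t h1 h2 a =>
    (((@measurable_estimationError Ω (ℱ (t - 1)) K _ _ _ _ γ (hNmeas t h1 h2)
      (hqmeas t h1 h2) (hpmeas t h1 h2) (hℓmeas t h1 h2) j a).sub
      ((@measurable_varianceProxy Ω (ℱ (t - 1)) K _ _ _ γ (hNmeas t h1 h2)
        (hqmeas t h1 h2) (hpmeas t h1 h2)).const_mul _)).const_mul _)
  obtain ⟨hm, hi, he⟩ := integral_exp_sum_le_one hℱle hℱmono hImeas hIlaw hXmeas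
    (fun t a ω => mul_estimationError_sub_le hγ0 (by linarith) (hqnn t ω) (hpnn t ω)
      (hpsum t ω) (hℓmem t ω) j a)
    (fun t ω => sum_mul_exp_estimationError_le_one hγ0 (hqnn t ω) (hqsum t ω) (hpnn t ω)
      (hpsum t ω) (hℓmem t ω) j) T le_rfl
  have hchernoff := ofReal_one_sub_le_measure_le_log (hm.mono (hℱle T) le_rfl) hi he hδ0
  refine (ENNReal.ofReal_le_ofReal (by linarith)).trans (hchernoff.trans (measure_mono ?_))
  intro ω hω
  simp only [Set.mem_ofPred_eq] at hω ⊢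
  have hterm : ∀ t, ∑ i ∈ Finset.univ.filter (fun i => i ∈ Nin t ω i),
      (p t ω i - (if i = j then (1 : ℝ) else 0)) * (ℓ t ω i - ℓhat t ω i) =
      estimationError γ (Nin t ω) (ptil t ω) (p t ω) (ℓ t ω) j (I t ω) := fun t => by
    refine Finset.sum_congr rfl fun i hi => ?_
    rw [hℓhat, if_pos (Finset.mem_filter.1 hi).2, hW]
  simp only [hterm]
  simp only [hXdef, ← hQeq, ← Finset.mul_sum, Finset.sum_sub_distrib] at hω
  set R := ∑ t ∈ Finset.Icc 1 T,
    estimationError γ (Nin t ω) (ptil t ω) (p t ω) (ℓ t ω) j (I t ω)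
  set V := ∑ t ∈ Finset.Icc 1 T, Q t ω
  have hV : 0 ≤ V := Finset.sum_nonneg fun t _ => hQnn t ω
  have hmax : 0 ≤ (Finset.Icc 1 T).sup' (Finset.nonempty_Icc.mpr hT) fun t => Q t ω :=
    (hQnn 1 ω).trans (Finset.le_sup' (fun t => Q t ω) (Finset.mem_Icc.2 ⟨le_rfl, hT⟩))
  have hL : 0 ≤ Real.log (1 / δ) := Real.log_nonneg (by rw [le_div_iff₀ hδ0]; linarith)
  have hK2 : (2 : ℝ) ≤ K := by exact_mod_cast hK
  have hT1 : (1 : ℝ) ≤ T := by exact_mod_cast hT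
  have hLK : Real.log (1 / δ) ≤ Real.log (K / δ) :=
    Real.log_le_log (by positivity) (div_le_div_of_nonneg_right (by linarith) hδ0.le)
  have hA : 1 ≤ Real.log ((K : ℝ) * T / (γ * δ)) := by
    rw [Real.le_log_iff_exp_le (by positivity), le_div_iff₀ (by positivity)]
    have h1 : γ * δ ≤ 1 / 2 := by nlinarith
    have h2 : (2 : ℝ) ≤ K * T := by nlinarith
    nlinarith [Real.exp_one_lt_d9, Real.exp_pos 1]
  have hR : R ≤ 2 * γ * V + 1 / γ * Real.log (1 / δ) := by
    have : R - 2 * γ * V ≤ Real.log (1 / δ) / γ := by rwa [le_div_iff₀' hγ0]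
    rw [one_div_mul_eq_div]
    linarith
  have hsqrt := Real.sqrt_nonneg (V * Real.log (1 / δ))
  have hmaxL := mul_nonneg hmax hL
  have hγV := mul_nonneg hγ0.le hV
  have hγL := mul_le_mul_of_nonneg_left hLK (one_div_nonneg.2 hγ0.le)
  have hγL0 := mul_nonneg (one_div_nonneg.2 hγ0.le) hL
  set S := Real.sqrt (V * Real.log (1 / δ)) +
    ((Finset.Icc 1 T).sup' (Finset.nonempty_Icc.mpr hT) fun t => Q t ω) * Real.log (1 / δ) +
    γ * V + 1 / γ * Real.log (K / δ)
  have hS0 : 0 ≤ S := by linarith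
  nlinarith [mul_le_mul_of_nonneg_right hA hS0]
end

section
/- There exists a universal constant C such that the following holds. Under the strongly observable graph algorithm with η ≤ 1/2, β ≤ 1/2 and γ ∈ (0,1/2], fix any arm j ∈ [K] and let Q_t = Σ_{i∈S_t} p_{t,i}/(W_{t,i}+γ). Then for every δ ∈ (0,1), with probability at least 1 − 2δ, Σ_{t=1}^T ⟨p_t − e_j, ℓ̂_t⟩ ≤ C · log(KT/(γδ)) · ( 1/η + ηT + η Σ_{t=1}^T Q_t + log(1/δ) + √(ηT) + β²T + (η/γ) · (max_{t∈[T]} Q_t) · log(1/δ) ) − β Σ_{t=1}^T (p_{t,j_t}/W_{t,j_t}) · 1{t ∈ 𝒯} + β Σ_{t=1}^T 1{t ∈ 𝒯, j = j_t}/W_{t,j_t}. -/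
open MeasureTheory

lemma exp_le_one_add_add_sq_s6 {y : ℝ} (hy : y ≤ 3) : Real.exp y ≤ 1 + y + 20 * y ^ 2 := by
  by_cases h1 : |y| ≤ 1
  · have := (abs_le.mp (Real.abs_exp_sub_one_sub_id_le h1)).2
    nlinarith [sq_nonneg y]
  rcases lt_abs.mp (not_le.mp h1) with h | h
  · have h3 : Real.exp y ≤ Real.exp 1 ^ 3 := by
      rw [← Real.exp_nat_mul]
      exact Real.exp_le_exp.mpr (by norm_num; exact hy)
    have h4 : Real.exp 1 ^ 3 ≤ 21 :=
      (pow_le_pow_left₀ (Real.exp_pos 1).le Real.exp_one_lt_d9.le 3).trans (by norm_num)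
    nlinarith
  · have : Real.exp y ≤ 1 := Real.exp_le_one_iff.mpr (by linarith)
    nlinarith

/-- The entropic mirror descent step is the multiplicative weights update. -/
lemma entropic_step_eq {ι : Type*} [Fintype ι] {η : ℝ} (hη : 0 < η) {y x L : ι → ℝ}
    (hy : ∀ i, 0 < y i) (hysum : ∑ i, y i = 1) (hx : ∀ i, 0 ≤ x i) (hxsum : ∑ i, x i = 1)
    (hmin : ∀ q : ι → ℝ, (∀ i, 0 ≤ q i) → ∑ i, q i = 1 →
      ∑ i, x i * L i + (1 / η) * ∑ i, (x i * Real.log (x i / y i) + y i - x i) ≤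
        ∑ i, q i * L i + (1 / η) * ∑ i, (q i * Real.log (q i / y i) + y i - q i)) (i : ι) :
    x i = y i * Real.exp (-(η * L i)) / ∑ k, y k * Real.exp (-(η * L k)) := by
  classical
  set Z := ∑ k, y k * Real.exp (-(η * L k)) with hZ
  have hZpos : 0 < Z := Finset.sum_pos (fun k _ => mul_pos (hy k) (Real.exp_pos _)) ⟨i, by simp⟩
  set q : ι → ℝ := fun k => y k * Real.exp (-(η * L k)) / Z with hq
  have hqpos : ∀ k, 0 < q k := fun k => div_pos (mul_pos (hy k) (Real.exp_pos _)) hZpos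
  have hqsum : ∑ k, q k = 1 := by
    rw [hq, ← Finset.sum_div, ← hZ, div_self hZpos.ne']
  have hlogq : ∀ k, Real.log (q k / y k) = -(η * L k) - Real.log Z := by
    intro k
    have : q k / y k = Real.exp (-(η * L k)) / Z := by
      have := (hy k).ne'
      simp only [hq]; field_simp
    rw [this, Real.log_div (Real.exp_pos _).ne' hZpos.ne', Real.log_exp]
  have hsplit : ∀ k, q k * InformationTheory.klFun (x k / q k) =
      x k * Real.log (x k / y k) + x k * (η * L k) + x k * Real.log Z + q k - x k := by
    intro k
    have hq0 := (hqpos k).ne'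
    have hy0 := (hy k).ne'
    rw [InformationTheory.klFun]
    rcases (hx k).eq_or_lt with h0 | h0
    · simp [← h0]
    · have : Real.log (x k / q k) = Real.log (x k / y k) - Real.log (q k / y k) := by
        rw [Real.log_div h0.ne' hq0, Real.log_div h0.ne' hy0, Real.log_div hq0 hy0]; ring
      rw [this, hlogq]
      field_simp
      ring
  have hkl : ∑ k, q k * InformationTheory.klFun (x k / q k) ≤ 0 := by
    have h := hmin q (fun k => (hqpos k).le) hqsum
    simp only [hlogq] at h
    have e1 : ∑ k, q k * InformationTheory.klFun (x k / q k) =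
        ∑ k, x k * Real.log (x k / y k) + η * ∑ k, x k * L k + Real.log Z := by
      simp only [hsplit, Finset.sum_add_distrib, Finset.sum_sub_distrib, ← Finset.sum_mul,
        hqsum, hxsum, Finset.mul_sum]
      rw [show ∑ k, x k * (η * L k) = ∑ k, η * (x k * L k) from
        Finset.sum_congr rfl fun k _ => by ring]
      ring
    have e2 : ∑ k, (q k * (-(η * L k) - Real.log Z) + y k - q k) =
        -(η * ∑ k, q k * L k) - Real.log Z := by
      simp only [Finset.sum_add_distrib, Finset.sum_sub_distrib, mul_sub, ← Finset.sum_mul,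
        hqsum, hysum, Finset.mul_sum]
      rw [show ∑ k, q k * (-(η * L k)) = -∑ k, η * (q k * L k) by
        rw [← Finset.sum_neg_distrib]; exact Finset.sum_congr rfl fun k _ => by ring]
      ring
    have e3 : ∑ k, (x k * Real.log (x k / y k) + y k - x k) = ∑ k, x k * Real.log (x k / y k) := by
      simp only [Finset.sum_add_distrib, Finset.sum_sub_distrib, hxsum, hysum]; ring
    rw [e2, e3] at h
    have h' := mul_le_mul_of_nonneg_left h hη.le
    field_simp at h'
    rw [e1]; linarith
  have hnn : ∀ k ∈ Finset.univ, 0 ≤ q k * InformationTheory.klFun (x k / q k) := fun k _ =>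
    mul_nonneg (hqpos k).le (InformationTheory.klFun_nonneg (div_nonneg (hx k) (hqpos k).le))
  have h0 := (Finset.sum_eq_zero_iff_of_nonneg hnn).mp
    (le_antisymm hkl (Finset.sum_nonneg hnn)) i (Finset.mem_univ i)
  have h1 := (InformationTheory.klFun_eq_zero_iff (div_nonneg (hx i) (hqpos i).le)).mp
    ((mul_eq_zero.mp h0).resolve_left (hqpos i).ne')
  exact (div_eq_one_iff_eq (hqpos i).ne').mp h1

/-- Regret of multiplicative weights against a fixed arm, with loss vectors shifted by `c t`. -/
lemma multiplicative_weights_regret {ι : Type*} [Fintype ι] [DecidableEq ι] {η : ℝ} (hη : 0 < η)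
    (T : ℕ)
    {p L : ℕ → ι → ℝ} {c : ℕ → ℝ} (hp1 : ∀ i, p 1 i = 1 / Fintype.card ι)
    (hpsum : ∀ t, ∑ i, p t i = 1)
    (hpnn : ∀ t i, 0 ≤ p t i)
    (hstep : ∀ t, 1 ≤ t → t ≤ T → (∀ i, 0 < p t i) → ∀ i,
      p (t + 1) i = p t i * Real.exp (-(η * L t i)) / ∑ k, p t k * Real.exp (-(η * L t k)))
    (hc : ∀ t, 1 ≤ t → t ≤ T → ∀ i, -3 ≤ η * (L t i - c t)) (j : ι) :
    ∑ t ∈ Finset.Icc 1 T, ∑ i, (p t i - (if i = j then (1 : ℝ) else 0)) * L t i ≤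
      Real.log (Fintype.card ι) / η +
        20 * η * ∑ t ∈ Finset.Icc 1 T, ∑ i, p t i * (L t i - c t) ^ 2 := by
  have : Nonempty ι := ⟨j⟩
  have hcard : (0 : ℝ) < Fintype.card ι := by exact_mod_cast Fintype.card_pos
  have key : ∀ n, n ≤ T → (∀ i, 0 < p (n + 1) i) ∧
      η * ∑ t ∈ Finset.Icc 1 n, ∑ i, (p t i - (if i = j then (1 : ℝ) else 0)) * L t i ≤
        Real.log (p (n + 1) j) + Real.log (Fintype.card ι) +
        20 * η ^ 2 * ∑ t ∈ Finset.Icc 1 n, ∑ i, p t i * (L t i - c t) ^ 2 := by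
    intro n
    induction n with
    | zero =>
      intro _
      refine ⟨fun i => by rw [zero_add, hp1]; positivity, ?_⟩
      simp [hp1]
    | succ n ih =>
      intro hn
      obtain ⟨hpos, hreg⟩ := ih (by omega)
      have hst := hstep (n + 1) (by omega) hn hpos
      set t := n + 1 with ht
      set Z := ∑ k, p t k * Real.exp (-(η * L t k)) with hZ
      have hZpos : 0 < Z :=
        Finset.sum_pos (fun k _ => mul_pos (hpos k) (Real.exp_pos _)) ⟨j, by simp⟩
      refine ⟨fun i => by rw [hst]; exact div_pos (mul_pos (hpos i) (Real.exp_pos _)) hZpos, ?_⟩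
      have hlog : Real.log (p (t + 1) j) = Real.log (p t j) - η * L t j - Real.log Z := by
        rw [hst, Real.log_div (mul_pos (hpos j) (Real.exp_pos _)).ne' hZpos.ne',
          Real.log_mul (hpos j).ne' (Real.exp_pos _).ne', Real.log_exp]
        ring
      have hZle : Z ≤ Real.exp (-(η * c t)) * (1 - η * ∑ i, p t i * L t i + η * c t
          + 20 * η ^ 2 * ∑ i, p t i * (L t i - c t) ^ 2) := by
        have e : 1 - η * ∑ i, p t i * L t i + η * c t
            + 20 * η ^ 2 * ∑ i, p t i * (L t i - c t) ^ 2 =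
            ∑ i, p t i * (1 + (-(η * (L t i - c t))) + 20 * (-(η * (L t i - c t))) ^ 2) := by
          have : ∀ i, p t i * (1 + (-(η * (L t i - c t))) + 20 * (-(η * (L t i - c t))) ^ 2) =
            p t i * (1 + η * c t) - η * (p t i * L t i) +
              20 * η ^ 2 * (p t i * (L t i - c t) ^ 2) := fun i => by ring
          simp only [this, Finset.sum_add_distrib, Finset.sum_sub_distrib, ← Finset.sum_mul,
            hpsum, ← Finset.mul_sum]
          ring
        rw [e, Finset.mul_sum, hZ]
        refine Finset.sum_le_sum fun i _ => ?_
        have h1 := exp_le_one_add_add_sq_s6 (y := -(η * (L t i - c t)))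
          (by linarith [hc t (by omega) hn i])
        have h2 : Real.exp (-(η * L t i)) =
            Real.exp (-(η * c t)) * Real.exp (-(η * (L t i - c t))) := by
          rw [← Real.exp_add]; congr 1; ring
        rw [h2, mul_left_comm]
        exact mul_le_mul_of_nonneg_left (mul_le_mul_of_nonneg_left h1 (hpnn t i))
          (Real.exp_pos _).le
      have hlogZ : Real.log Z ≤ - η * ∑ i, p t i * L t i
          + 20 * η ^ 2 * ∑ i, p t i * (L t i - c t) ^ 2 := by
        rw [Real.log_le_iff_le_exp hZpos]
        refine hZle.trans ?_
        rw [show - η * ∑ i, p t i * L t i + 20 * η ^ 2 * ∑ i, p t i * (L t i - c t) ^ 2 =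
          -(η * c t) + (- η * ∑ i, p t i * L t i + η * c t +
            20 * η ^ 2 * ∑ i, p t i * (L t i - c t) ^ 2) by ring, Real.exp_add]
        refine mul_le_mul_of_nonneg_left ?_ (Real.exp_pos _).le
        refine le_trans (le_of_eq ?_) (Real.add_one_le_exp _)
        ring
      have hinner : ∑ i, (p t i - (if i = j then (1 : ℝ) else 0)) * L t i =
          ∑ i, p t i * L t i - L t j := by
        simp [sub_mul, Finset.sum_sub_distrib]
      rw [Finset.sum_Icc_succ_top (by omega), Finset.sum_Icc_succ_top (by omega), ← ht, hinner,
        hlog]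
      linarith
  obtain ⟨hpos, h⟩ := key T le_rfl
  have hle1 : p (T + 1) j ≤ 1 :=
    (Finset.single_le_sum (fun i _ => hpnn (T + 1) i) (Finset.mem_univ j)).trans_eq (hpsum _)
  have hl := Real.log_nonpos (hpnn _ _) hle1
  have h2 := h.trans (add_le_add_left (add_le_add_left hl _) _)
  rw [show Real.log (Fintype.card ι) / η +
        20 * η * ∑ t ∈ Finset.Icc 1 T, ∑ i, p t i * (L t i - c t) ^ 2 = (Real.log (Fintype.card ι)
        + 20 * η ^ 2 * ∑ t ∈ Finset.Icc 1 T, ∑ i, p t i * (L t i - c t) ^ 2) / η by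
        field_simp, le_div_iff₀ hη]
  linarith

/-- Multiplicative Chernoff bound for a `[0,1]`-valued predictable function `f t` of an adapted
random action `I t` with conditional law `q t`. -/
lemma measure_log_lt_sum_sub_le {Ω : Type*} {mΩ : MeasurableSpace Ω} {μ : Measure Ω}
    [IsProbabilityMeasure μ] {ℱ : ℕ → MeasurableSpace Ω} (hle : ∀ t, ℱ t ≤ mΩ)
    (hmono : Monotone ℱ) {ι : Type*} [Fintype ι] [MeasurableSpace ι] [MeasurableSingletonClass ι]
    {T : ℕ} {I : ℕ → Ω → ι} {q f : ℕ → Ω → ι → ℝ}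
    (hI : ∀ t, 1 ≤ t → t ≤ T → Measurable[ℱ t] (I t))
    (hq : ∀ t, 1 ≤ t → t ≤ T → ∀ i, Measurable[ℱ (t - 1)] fun ω => q t ω i)
    (hqnn : ∀ t ω i, 0 ≤ q t ω i) (hqsum : ∀ t ω, ∑ i, q t ω i = 1)
    (hlaw : ∀ t, 1 ≤ t → t ≤ T → ∀ i,
      (μ[fun ω => Set.indicator {ω' | I t ω' = i} (fun _ => (1 : ℝ)) ω | ℱ (t - 1)])
        =ᵐ[μ] fun ω => q t ω i)
    (hf : ∀ t, 1 ≤ t → t ≤ T → ∀ i, Measurable[ℱ (t - 1)] fun ω => f t ω i)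
    (hfnn : ∀ t, 1 ≤ t → t ≤ T → ∀ ω i, 0 ≤ f t ω i)
    (hf1 : ∀ t, 1 ≤ t → t ≤ T → ∀ ω i, f t ω i ≤ 1)
    {δ : ℝ} (hδ : 0 < δ) :
    μ {ω | Real.log (1 / δ) < ∑ t ∈ Finset.Icc 1 T,
      (f t ω (I t ω) - 2 * ∑ i, q t ω i * f t ω i)} ≤ ENNReal.ofReal δ := by
  classical
  set M : ℕ → Ω → ℝ := fun n ω => Real.exp (∑ t ∈ Finset.Icc 1 n,
      (f t ω (I t ω) - 2 * ∑ i, q t ω i * f t ω i)) with hM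
  have hsplit : ∀ t ω, ∀ g : ι → ℝ,
      g (I t ω) = ∑ i, g i * Set.indicator {ω' | I t ω' = i} (fun _ => (1 : ℝ)) ω := by
    intro t ω g
    simp [Set.indicator_apply]
  have hind : ∀ t, 1 ≤ t → t ≤ T → ∀ i,
      Measurable[ℱ t] (Set.indicator {ω' | I t ω' = i} (fun _ => (1 : ℝ))) := by
    intro t h1 h2 i
    exact measurable_const.indicator (hI t h1 h2 (measurableSet_singleton i))
  have hA : ∀ t, 1 ≤ t → t ≤ T → Measurable[ℱ (t - 1)] fun ω => ∑ i, q t ω i * f t ω i :=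
    fun t h1 h2 => Finset.measurable_sum _ fun i _ => (hq t h1 h2 i).mul (hf t h1 h2 i)
  have hAnn : ∀ t, 1 ≤ t → t ≤ T → ∀ ω, 0 ≤ ∑ i, q t ω i * f t ω i := fun t h1 h2 ω =>
    Finset.sum_nonneg fun i _ => mul_nonneg (hqnn t ω i) (hfnn t h1 h2 ω i)
  have hMpos : ∀ n ω, 0 < M n ω := fun n ω => Real.exp_pos _
  have hMb : ∀ n, n ≤ T → ∀ ω, M n ω ≤ Real.exp n := by
    intro n hn ω
    refine Real.exp_le_exp.mpr ?_
    calc _ ≤ ∑ t ∈ Finset.Icc 1 n, (1 : ℝ) := Finset.sum_le_sum fun t ht => by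
            have h := Finset.mem_Icc.mp ht
            linarith [hAnn t h.1 (h.2.trans hn) ω, hf1 t h.1 (h.2.trans hn) ω (I t ω)]
      _ = n := by simp
  have hMm : ∀ n, n ≤ T → Measurable[ℱ n] (M n) := by
    intro n hn
    refine Real.measurable_exp.comp (Finset.measurable_sum _ fun t ht => ?_)
    obtain ⟨h1, h2⟩ := Finset.mem_Icc.mp ht
    have h3 := h2.trans hn
    refine Measurable.sub ?_ (((hA t h1 h3).mono (hmono (by omega)) le_rfl).const_mul 2)
    simp only [hsplit t _ (f t _)]
    exact Finset.measurable_sum _ fun i _ => ((hf t h1 h3 i).mono (hmono (by omega)) le_rfl).mul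
      ((hind t h1 h3 i).mono (hmono h2) le_rfl)
  have hMint : ∀ n, n ≤ T → Integrable (M n) μ := fun n hn =>
    Integrable.of_bound ((hMm n hn).mono (hle n) le_rfl).aestronglyMeasurable (Real.exp n)
      (ae_of_all _ fun ω => by
        rw [Real.norm_of_nonneg (hMpos n ω).le]; exact hMb n hn ω)
  have hM1 : ∀ n, n ≤ T → ∫ ω, M n ω ∂μ ≤ 1 := by
    intro n
    induction n with
    | zero => intro _; simp [hM]
    | succ n ih =>
      intro hn
      refine le_trans ?_ (ih (by omega))
      set G : ι → Ω → ℝ := fun i ω => M n ω *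
        Real.exp (-(2 * ∑ i, q (n + 1) ω i * f (n + 1) ω i)) * Real.exp (f (n + 1) ω i) with hG
      have hGnn : ∀ i ω, 0 ≤ G i ω := fun i ω =>
        mul_nonneg (mul_nonneg (hMpos n ω).le (Real.exp_pos _).le) (Real.exp_pos _).le
      have hGm : ∀ i, Measurable[ℱ n] (G i) := fun i =>
        ((hMm n (by omega)).mul (Real.measurable_exp.comp
          (((hA (n + 1) (by omega) hn)).const_mul 2).neg)).mul
          (Real.measurable_exp.comp (hf (n + 1) (by omega) hn i))
      have hGb : ∀ i ω, G i ω ≤ Real.exp n * Real.exp 1 := by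
        intro i ω
        have h1 : Real.exp (-(2 * ∑ i, q (n + 1) ω i * f (n + 1) ω i)) ≤ 1 :=
          Real.exp_le_one_iff.mpr (by linarith [hAnn (n + 1) (by omega) hn ω])
        have h2 := mul_le_mul (hMb n (by omega) ω) h1 (Real.exp_pos _).le (Real.exp_pos _).le
        rw [mul_one] at h2
        exact mul_le_mul h2 (Real.exp_le_exp.mpr (hf1 (n + 1) (by omega) hn ω i))
          (Real.exp_pos _).le (Real.exp_pos _).le
      have hGint : ∀ i, ∀ g : Ω → ℝ, Measurable g → (∀ ω, 0 ≤ g ω) → (∀ ω, g ω ≤ 1) →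
          Integrable (fun ω => G i ω * g ω) μ := by
        intro i g hg hg0 hg1
        refine Integrable.of_bound
          (((hGm i).mono (hle n) le_rfl).mul hg).aestronglyMeasurable (Real.exp n * Real.exp 1)
          (ae_of_all _ fun ω => ?_)
        rw [Real.norm_of_nonneg (mul_nonneg (hGnn i ω) (hg0 ω))]
        exact (mul_le_of_le_one_right (hGnn i ω) (hg1 ω)).trans (hGb i ω)
      have hindm : ∀ i, Measurable (Set.indicator {ω' | I (n + 1) ω' = i} (fun _ => (1 : ℝ))) :=
        fun i => (hind (n + 1) (by omega) hn i).mono (hle _) le_rfl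
      have hind0 : ∀ i ω, 0 ≤ Set.indicator {ω' | I (n + 1) ω' = i} (fun _ => (1 : ℝ)) ω :=
        fun i ω => Set.indicator_nonneg (fun _ _ => zero_le_one) ω
      have hind1 : ∀ i ω, Set.indicator {ω' | I (n + 1) ω' = i} (fun _ => (1 : ℝ)) ω ≤ 1 :=
        fun i ω => Set.indicator_le_self' (fun _ _ => zero_le_one) ω
      have hq1 : ∀ i ω, q (n + 1) ω i ≤ 1 := fun i ω =>
        (Finset.single_le_sum (fun i _ => hqnn (n + 1) ω i) (Finset.mem_univ i)).trans_eq
          (hqsum _ ω)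
      have hqm : ∀ i, Measurable fun ω => q (n + 1) ω i := fun i =>
        (hq (n + 1) (by omega) hn i).mono (hle _) le_rfl
      have hswap : ∀ i, ∫ ω, G i ω * Set.indicator {ω' | I (n + 1) ω' = i} (fun _ => (1 : ℝ)) ω ∂μ
          = ∫ ω, G i ω * q (n + 1) ω i ∂μ := by
        intro i
        have hgint : Integrable (Set.indicator {ω' | I (n + 1) ω' = i} (fun _ => (1 : ℝ))) μ :=
          Integrable.of_bound (hindm i).aestronglyMeasurable 1 (ae_of_all _ fun ω => by
            rw [Real.norm_of_nonneg (hind0 i ω)]; exact hind1 i ω)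
        have h1 := condExp_mul_of_stronglyMeasurable_left (hGm i).stronglyMeasurable
          (hGint i _ (hindm i) (hind0 i) (hind1 i)) hgint
        have h2 := hlaw (n + 1) (by omega) hn i
        rw [← integral_condExp (hle n)]
        refine integral_congr_ae ?_
        filter_upwards [h1, h2] with ω h1 h2
        refine h1.trans ?_
        rw [Pi.mul_apply]
        exact congrArg _ h2
      have hstep : ∀ ω, M (n + 1) ω =
          ∑ i, G i ω * Set.indicator {ω' | I (n + 1) ω' = i} (fun _ => (1 : ℝ)) ω := by
        intro ω
        rw [← hsplit (n + 1) ω (fun i => G i ω)]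
        simp only [hM, hG]
        rw [Finset.sum_Icc_succ_top (by omega), ← Real.exp_add, ← Real.exp_add]
        congr 1; ring
      simp only [hstep]
      rw [integral_finsetSum _ fun i _ => hGint i _ (hindm i) (hind0 i) (hind1 i)]
      simp only [hswap]
      rw [← integral_finsetSum _ fun i _ => hGint i _ (hqm i) (fun ω => hqnn _ ω i) (hq1 i)]
      refine integral_mono (integrable_finsetSum _ fun i _ =>
        hGint i _ (hqm i) (fun ω => hqnn _ ω i) (hq1 i)) (hMint n (by omega)) fun ω => ?_
      have hexp : ∑ i, q (n + 1) ω i * Real.exp (f (n + 1) ω i) ≤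
          Real.exp (2 * ∑ i, q (n + 1) ω i * f (n + 1) ω i) := by
        calc _ ≤ ∑ i, q (n + 1) ω i * (1 + 2 * f (n + 1) ω i) := by
              refine Finset.sum_le_sum fun i _ => mul_le_mul_of_nonneg_left ?_ (hqnn _ ω i)
              have h0 := hfnn (n + 1) (by omega) hn ω i
              have h1 := hf1 (n + 1) (by omega) hn ω i
              have := (abs_le.mp (Real.abs_exp_sub_one_sub_id_le
                (abs_le.mpr ⟨by linarith, h1⟩))).2
              nlinarith
          _ = 2 * ∑ i, q (n + 1) ω i * f (n + 1) ω i + 1 := by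
              simp only [mul_add, Finset.sum_add_distrib, mul_one, hqsum, Finset.mul_sum]
              rw [add_comm]
              congr 1
              exact Finset.sum_congr rfl fun i _ => by ring
          _ ≤ _ := Real.add_one_le_exp _
      calc ∑ i, G i ω * q (n + 1) ω i
          = M n ω * (Real.exp (-(2 * ∑ i, q (n + 1) ω i * f (n + 1) ω i)) *
              ∑ i, q (n + 1) ω i * Real.exp (f (n + 1) ω i)) := by
            simp only [hG, Finset.mul_sum]
            exact Finset.sum_congr rfl fun i _ => by ring
        _ ≤ M n ω * 1 := by
            refine mul_le_mul_of_nonneg_left ?_ (hMpos n ω).le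
            refine (mul_le_mul_of_nonneg_left hexp (Real.exp_pos _).le).trans_eq ?_
            rw [← Real.exp_add]; simp
        _ = M n ω := mul_one _
  have hmk := (mul_meas_ge_le_integral_of_nonneg (ae_of_all _ fun ω => (hMpos T ω).le)
    (hMint T le_rfl) (1 / δ)).trans (hM1 T le_rfl)
  have hreal : μ.real {ω | 1 / δ ≤ M T ω} ≤ δ := by
    rw [one_div, inv_mul_le_iff₀ hδ, mul_one] at hmk
    simpa only [one_div] using hmk
  calc _ ≤ μ {ω | 1 / δ ≤ M T ω} := measure_mono fun ω hω => by
          refine ((Real.log_le_iff_le_exp (by positivity)).mp (le_of_lt ?_))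
          exact hω
    _ ≤ ENNReal.ofReal δ := (ENNReal.le_ofReal_iff_toReal_le (measure_ne_top _ _) hδ.le).mpr hreal

/-- Contribution of the nodes with a self-loop to the second moment of the loss estimator, when
action `a` is played. -/
noncomputable def selfLoopVar {ι : Type*} [Fintype ι] [DecidableEq ι] (N : ι → Finset ι)
    (p W : ι → ℝ) (γ : ℝ) (a : ι) : ℝ :=
  ∑ i, if i ∈ N i ∧ a ∈ N i then p i / (W i + γ) ^ 2 else 0

/-- Contribution of the nodes without a self-loop to the first moment of the importance weights,
when action `a` is played. -/
noncomputable def loopFreeVar {ι : Type*} [Fintype ι] [DecidableEq ι] (N : ι → Finset ι)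
    (p W : ι → ℝ) (a : ι) : ℝ :=
  ∑ i, if i ∉ N i ∧ a ≠ i then p i / W i else 0

section Round

variable {K : ℕ} {η β γ : ℝ} {N : Fin K → Finset (Fin K)} {p q W ℓ ℓhat b : Fin K → ℝ}

lemma mixed_nonneg (hη0 : 0 < η) (hηhalf : η ≤ 1 / 2)
    (hp : ∀ i, 0 ≤ p i) (hq : ∀ i, q i = (1 - η) * p i + η / K) (i : Fin K) : 0 ≤ q i := by
  rw [hq]
  have := hp i
  have : 0 ≤ (1 - η) * p i := mul_nonneg (by linarith) this
  positivity

lemma mixed_sum (hK : 2 ≤ K) (hpsum : ∑ i, p i = 1)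
    (hq : ∀ i, q i = (1 - η) * p i + η / K) : ∑ i, q i = 1 := by
  have : (K : ℝ) ≠ 0 := by positivity
  simp only [hq, Finset.sum_add_distrib, ← Finset.mul_sum, hpsum, Finset.sum_const,
    Finset.card_univ, Fintype.card_fin, nsmul_eq_mul]
  field_simp
  ring

lemma observation_loopFree (hK : 2 ≤ K) (hη0 : 0 < η) (hpsum : ∑ i, p i = 1)
    (hq : ∀ i, q i = (1 - η) * p i + η / K) (hW : ∀ i, W i = ∑ k ∈ N i, q k)
    {i : Fin K} (hN : i ∈ N i ∨ N i = Finset.univ.erase i) (hi : i ∉ N i) :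
    (1 - η) * (1 - p i) + η / 2 ≤ W i := by
  have h1 : W i = 1 - q i := by
    rw [hW, hN.resolve_left hi, ← mixed_sum hK hpsum hq,
      ← Finset.sum_erase_add _ _ (Finset.mem_univ i)]
    ring
  have h2 : η / K ≤ η / 2 := div_le_div_of_nonneg_left hη0.le two_pos (by exact_mod_cast hK)
  rw [h1, hq]
  linarith

lemma selfLoopVar_nonneg (hp : ∀ i, 0 ≤ p i) (a : Fin K) : 0 ≤ selfLoopVar N p W γ a := by
  refine Finset.sum_nonneg fun i _ => ?_
  have := hp i
  split_ifs <;> positivity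

lemma loopFreeVar_nonneg (hp : ∀ i, 0 ≤ p i) (hW : ∀ i, 0 ≤ W i) (a : Fin K) :
    0 ≤ loopFreeVar N p W a := by
  refine Finset.sum_nonneg fun i _ => ?_
  have := hp i
  have := hW i
  split_ifs <;> positivity

lemma selfLoopVar_le (hγ : 0 < γ) (hp : ∀ i, 0 ≤ p i) (hW : ∀ i, 0 ≤ W i) (a : Fin K) :
    selfLoopVar N p W γ a ≤
      (∑ i ∈ Finset.univ.filter (fun i => i ∈ N i), p i / (W i + γ)) / γ := by
  rw [Finset.sum_filter, Finset.sum_div, selfLoopVar]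
  refine Finset.sum_le_sum fun i _ => ?_
  have h1 := hp i
  have h2 := hW i
  by_cases h : i ∈ N i
  · simp only [h, true_and, if_true]
    have h3 : p i / (W i + γ) ^ 2 ≤ p i / (W i + γ) / γ := by
      rw [div_div]
      exact div_le_div_of_nonneg_left h1 (by positivity) (by nlinarith)
    split_ifs
    · exact h3
    · positivity
  · simp [h]

lemma sum_mul_selfLoopVar_le (hγ : 0 < γ) (hp : ∀ i, 0 ≤ p i) (hW0 : ∀ i, 0 ≤ W i)
    (hW : ∀ i, W i = ∑ k ∈ N i, q k) :
    ∑ a, q a * selfLoopVar N p W γ a ≤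
      ∑ i ∈ Finset.univ.filter (fun i => i ∈ N i), p i / (W i + γ) := by
  simp only [selfLoopVar, Finset.mul_sum]
  rw [Finset.sum_comm, Finset.sum_filter]
  refine Finset.sum_le_sum fun i _ => ?_
  by_cases h : i ∈ N i
  · simp only [h, true_and, if_true, mul_ite, mul_zero, Finset.sum_ite_mem, Finset.univ_inter,
      ← Finset.sum_mul, ← hW]
    have h1 := hp i
    have h2 := hW0 i
    rw [mul_div_assoc', div_le_div_iff₀ (by positivity) (by positivity)]
    have : 0 ≤ p i * γ * (W i + γ) := by positivity
    nlinarith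
  · simp [h]

lemma loopFreeVar_le (hη0 : 0 < η) (hp : ∀ i, 0 ≤ p i) (hpsum : ∑ i, p i = 1)
    (hWη : ∀ i, i ∉ N i → η / 2 ≤ W i) (a : Fin K) : η / 2 * loopFreeVar N p W a ≤ 1 := by
  rw [loopFreeVar, Finset.mul_sum, ← hpsum]
  refine Finset.sum_le_sum fun i _ => ?_
  split_ifs with h
  · have h1 := hWη i h.1
    have h2 : 0 < W i := by linarith
    rw [mul_div_assoc', div_le_iff₀ h2, mul_comm]
    exact mul_le_mul_of_nonneg_left h1 (hp i)
  · simpa using hp i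

lemma sum_mul_loopFreeVar_le (hp : ∀ i, 0 ≤ p i)
    (hpsum : ∑ i, p i = 1) (hWpos : ∀ i, i ∉ N i → 0 < W i)
    (hN : ∀ i, i ∈ N i ∨ N i = Finset.univ.erase i) (hW : ∀ i, W i = ∑ k ∈ N i, q k) :
    ∑ a, q a * loopFreeVar N p W a ≤ 1 := by
  simp only [loopFreeVar, Finset.mul_sum]
  rw [Finset.sum_comm, ← hpsum]
  refine Finset.sum_le_sum fun i _ => ?_
  by_cases h : i ∈ N i
  · simpa [h] using hp i
  · have h1 : ∀ a, (i ∉ N i ∧ a ≠ i) ↔ a ∈ N i := by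
      intro a; rw [(hN i).resolve_left h]; simp
    simp only [h1, mul_ite, mul_zero, Finset.sum_ite_mem, Finset.univ_inter,
      ← Finset.sum_mul, ← hW]
    rw [mul_div_cancel₀ _ (hWpos i h).ne']

/-- In every round the biased loss estimates admit a shift that keeps them above `-3 / η` and
controls their local second moment. -/
lemma exists_shift_second_moment_le (hη0 : 0 < η) (hηhalf : η ≤ 1 / 2)
    (hβ0 : 0 < β) (hβhalf : β ≤ 1 / 2) (hγ : 0 < γ)
    (hℓ : ∀ i, ℓ i ∈ Set.Icc (0 : ℝ) 1)
    (hp : ∀ i, 0 ≤ p i) (hpsum : ∑ i, p i = 1) (hW0 : ∀ i, 0 ≤ W i)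
    (hWlow : ∀ i, i ∉ N i → (1 - η) * (1 - p i) + η / 2 ≤ W i) (a : Fin K)
    (hℓhat : ∀ i, ℓhat i = if i ∈ N i then (if a ∈ N i then ℓ i / (W i + γ) else 0)
      else (if a ≠ i then ℓ i / W i else 0))
    (hb : (∃ k, k ∉ N k ∧ 1 / 2 < p k ∧ b k = β / W k ∧ ∀ i, i ≠ k → b i = 0) ∨
      ((∀ i, i ∉ N i → p i ≤ 1 / 2) ∧ ∀ i, b i = 0)) :
    ∃ c, (∀ i, -3 ≤ η * (ℓhat i + b i - c)) ∧
      η * ∑ i, p i * (ℓhat i + b i - c) ^ 2 ≤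
        3 * η * (selfLoopVar N p W γ a + 4 + 4 * loopFreeVar N p W a) + 12 * β ^ 2 := by
  have hp1 : ∀ i, p i ≤ 1 := fun i =>
    (Finset.single_le_sum (fun i _ => hp i) (Finset.mem_univ i)).trans_eq hpsum
  have hWη : ∀ i, i ∉ N i → η / 2 ≤ W i := fun i h => by
    have := hWlow i h
    have : 0 ≤ (1 - η) * (1 - p i) := mul_nonneg (by linarith) (by linarith [hp1 i])
    linarith
  have hX := loopFreeVar_nonneg (N := N) hp hW0 a
  have hℓ0 : ∀ i, 0 ≤ ℓhat i := fun i => by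
    have h1 := (hℓ i).1
    have h2 := hW0 i
    rw [hℓhat]; split_ifs <;> positivity
  have hcore : ∀ i, (i ∈ N i ∨ p i ≤ 1 / 2) → p i * ℓhat i ^ 2 ≤
      (if i ∈ N i ∧ a ∈ N i then p i / (W i + γ) ^ 2 else 0) + 4 * p i := by
    intro i hi
    have h1 := hℓ i
    have h2 := hW0 i
    have h3 := hp i
    have h1' : ℓ i ^ 2 ≤ 1 := by nlinarith [h1.1, h1.2]
    rw [hℓhat]
    by_cases h : i ∈ N i
    · by_cases h' : a ∈ N i
      · simp only [h, h', if_true, and_self, div_pow]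
        have : p i * (ℓ i ^ 2 / (W i + γ) ^ 2) ≤ p i / (W i + γ) ^ 2 := by
          rw [mul_div_assoc']
          exact div_le_div_of_nonneg_right (mul_le_of_le_one_right h3 h1') (by positivity)
        linarith
      · simp [h, h', h3]
    · have h4 : 1 / 2 ≤ W i := by
        have := hWlow i h
        have := hi.resolve_left h
        nlinarith
      simp only [h, if_false, false_and, zero_add]
      split_ifs
      · have h5 : ℓ i / W i ≤ 2 := by
          rw [div_le_iff₀ (by linarith)]; linarith [h1.2]
        have h6 : 0 ≤ ℓ i / W i := div_nonneg h1.1 h2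
        have : (ℓ i / W i) ^ 2 ≤ 4 := by nlinarith
        nlinarith
      · simp [h3]
  rcases hb with ⟨k, hk, hpk, hbk, hbi⟩ | ⟨hle, hbi⟩
  · have hWk := hWη k hk
    have hWk0 : 0 < W k := by linarith
    have hWk' : (1 - p k) / 2 ≤ W k := by
      have := hWlow k hk
      have : (1 : ℝ) / 2 * (1 - p k) ≤ (1 - η) * (1 - p k) :=
        mul_le_mul_of_nonneg_right (by linarith) (by linarith [hp1 k])
      linarith
    have hℓk : ℓhat k ≤ if a ≠ k then 1 / W k else 0 := by
      rw [hℓhat, if_neg hk]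
      split_ifs
      · exact div_le_div_of_nonneg_right (hℓ k).2 hWk0.le
      · exact le_rfl
    have hℓk1 : ℓhat k ≤ 1 / W k := hℓk.trans (by
      split_ifs
      · exact le_rfl
      · positivity)
    have hηW : η / W k ≤ 2 := by rw [div_le_iff₀ hWk0]; linarith
    refine ⟨ℓhat k + b k, fun i => ?_, ?_⟩
    · rcases eq_or_ne i k with rfl | h
      · simp
      · rw [hbi i h, hbk]
        have h1 : η * ℓhat k ≤ η / W k := by
          rw [div_eq_mul_one_div]; exact mul_le_mul_of_nonneg_left hℓk1 hη0.le
        have h2 : η * (β / W k) = β * (η / W k) := by ring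
        have h3 : 0 ≤ η * ℓhat i := mul_nonneg hη0.le (hℓ0 i)
        have h4 : 0 ≤ η / W k := by positivity
        nlinarith
    · have hsq : (1 - p k) * ℓhat k ^ 2 ≤ 4 * loopFreeVar N p W a := by
        by_cases h : a ≠ k
        · have h1 : p k / W k ≤ loopFreeVar N p W a := by
            have h0 := Finset.single_le_sum
              (f := fun i => if i ∉ N i ∧ a ≠ i then p i / W i else 0)
              (fun i _ => by
                have := hp i
                have := hW0 i
                split_ifs <;> positivity) (Finset.mem_univ k)
            simpa only [hk, h, not_false_eq_true, ne_eq, and_self, if_true, loopFreeVar] using h0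
          have h2 : ℓhat k ^ 2 ≤ (1 / W k) ^ 2 := pow_le_pow_left₀ (hℓ0 k) hℓk1 2
          have h3 : (1 - p k) * (1 / W k) ^ 2 ≤ 2 / W k := by
            rw [div_pow, one_pow, mul_one_div, div_le_div_iff₀ (by positivity) hWk0]
            nlinarith
          have h4 : 2 / W k ≤ 4 * (p k / W k) := by
            rw [mul_div_assoc']
            exact div_le_div_of_nonneg_right (by linarith) hWk0.le
          have h5 := mul_le_mul_of_nonneg_left h2 (sub_nonneg.mpr (hp1 k))
          linarith
        · have h0 : ℓhat k = 0 := le_antisymm (by simpa [h] using hℓk) (hℓ0 k)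
          rw [h0]; simpa using hX
      have hbsq : η * ((1 - p k) * b k ^ 2) ≤ 4 * β ^ 2 := by
        have h1 : η * ((1 - p k) * b k ^ 2) = (η / W k) * ((1 - p k) / W k) * β ^ 2 := by
          rw [hbk]; field_simp
        have h2 : (1 - p k) / W k ≤ 2 := by rw [div_le_iff₀ hWk0]; linarith
        have h3 : 0 ≤ (1 - p k) / W k := div_nonneg (by linarith [hp1 k]) hWk0.le
        have h4 : (η / W k) * ((1 - p k) / W k) ≤ 2 * 2 := mul_le_mul hηW h2 h3 (by norm_num)
        rw [h1]
        nlinarith [sq_nonneg β]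
      have hterm : ∀ i, p i * (ℓhat i + b i - (ℓhat k + b k)) ^ 2 ≤
          3 * ((if i ∈ N i ∧ a ∈ N i then p i / (W i + γ) ^ 2 else 0) + 4 * p i) +
          3 * ((p i - if i = k then p k else 0) * (ℓhat k ^ 2 + b k ^ 2)) := by
        intro i
        rcases eq_or_ne i k with rfl | h
        · simp only [hk, false_and, if_false, if_true, sub_self]
          nlinarith [hp i]
        · have h1 := hcore i (Or.inr (by
            have h2 := Finset.add_le_sum (fun i _ => hp i) (Finset.mem_univ i)
              (Finset.mem_univ k) h
            rw [hpsum] at h2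
            linarith))
          rw [hbi i h, if_neg h, sub_zero, add_zero]
          have h2 : (ℓhat i - (ℓhat k + b k)) ^ 2 ≤ 3 * (ℓhat i ^ 2 + (ℓhat k ^ 2 + b k ^ 2)) := by
            nlinarith [sq_nonneg (ℓhat i + ℓhat k), sq_nonneg (ℓhat i + b k),
              sq_nonneg (ℓhat k - b k)]
          have h3 := mul_le_mul_of_nonneg_left h2 (hp i)
          linarith
      have hsum := Finset.sum_le_sum fun i (_ : i ∈ Finset.univ) => hterm i
      simp only [Finset.sum_add_distrib, ← Finset.mul_sum, ← Finset.sum_mul,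
        Finset.sum_sub_distrib, Finset.sum_ite_eq', Finset.mem_univ, if_true, hpsum] at hsum
      have hsum' := mul_le_mul_of_nonneg_left hsum hη0.le
      have hsq' := mul_le_mul_of_nonneg_left hsq hη0.le
      rw [selfLoopVar]
      linarith
  · refine ⟨0, fun i => ?_, ?_⟩
    · rw [hbi]
      have := mul_nonneg hη0.le (hℓ0 i)
      linarith
    · have hY := selfLoopVar_nonneg (N := N) (W := W) (γ := γ) hp a
      have hsum := Finset.sum_le_sum fun i (_ : i ∈ Finset.univ) =>
        hcore i (or_iff_not_imp_left.mpr (hle i))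
      rw [Finset.sum_add_distrib, ← Finset.mul_sum, hpsum, ← selfLoopVar] at hsum
      have hsum' := mul_le_mul_of_nonneg_left hsum hη0.le
      simp only [hbi, add_zero, sub_zero]
      have h1 := mul_nonneg hη0.le hX
      have h2 := mul_nonneg hη0.le hY
      nlinarith [sq_nonneg β]

end Round

/-- A union bound in complement form, without measurability assumptions on the good event. -/
lemma ofReal_one_sub_two_mul_le_measure {Ω : Type*} [MeasurableSpace Ω] {μ : Measure Ω}
    [IsProbabilityMeasure μ] {δ : ℝ} (hδ : 0 < δ) {N : ℕ} (hN : 0 < N) {A G : Set Ω}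
    {B : ℕ → Set Ω} (hA : μ A ≤ ENNReal.ofReal δ)
    (hB : ∀ k < N, μ (B k) ≤ ENNReal.ofReal (δ / N))
    (hG : ∀ ω, ω ∉ A → (∀ k < N, ω ∉ B k) → ω ∈ G) :
    ENNReal.ofReal (1 - 2 * δ) ≤ μ G := by
  have hBU : μ (⋃ k ∈ Finset.range N, B k) ≤ ENNReal.ofReal δ := by
    refine (measure_biUnion_finset_le _ _).trans ?_
    refine (Finset.sum_le_sum fun k hk => hB k (Finset.mem_range.mp hk)).trans_eq ?_
    rw [← ENNReal.ofReal_sum_of_nonneg fun _ _ => by positivity]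
    have : (N : ℝ) ≠ 0 := by positivity
    simp only [Finset.sum_const, Finset.card_range, nsmul_eq_mul]
    rw [mul_div_cancel₀ _ this]
  have hcover : Set.univ ⊆ G ∪ (A ∪ ⋃ k ∈ Finset.range N, B k) := by
    intro ω _
    by_contra h
    simp only [Set.mem_union, Set.mem_iUnion, Finset.mem_range, not_or, not_exists] at h
    exact h.1 (hG ω h.2.1 h.2.2)
  have h1 : (1 : ENNReal) ≤ μ G + ENNReal.ofReal (2 * δ) := by
    rw [← measure_univ (μ := μ), two_mul, ENNReal.ofReal_add hδ.le hδ.le]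
    exact (measure_mono hcover).trans ((measure_union_le _ _).trans
      (add_le_add le_rfl ((measure_union_le _ _).trans (add_le_add hA hBU))))
  rw [ENNReal.ofReal_sub _ (by positivity), ENNReal.ofReal_one]
  exact tsub_le_iff_right.mpr h1

/-- The dyadic scale just above `m / γ`. -/
lemma exists_dyadic_scale {γ m : ℝ} (hγ : 0 < γ) (hm0 : 0 ≤ m) (hm : m ≤ 1 / γ) :
    ∃ k < ⌈1 / γ ^ 2⌉₊ + 1, m ≤ γ * 2 ^ k ∧ (2 : ℝ) ^ k ≤ 1 + 2 * (m / γ) := by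
  have hex : m ≤ γ * 2 ^ ⌈1 / γ ^ 2⌉₊ := by
    have h1 : 1 / γ ^ 2 ≤ (2 : ℝ) ^ ⌈1 / γ ^ 2⌉₊ :=
      (Nat.le_ceil _).trans (by exact_mod_cast Nat.lt_two_pow_self.le)
    have h2 := mul_le_mul_of_nonneg_left h1 hγ.le
    rw [show γ * (1 / γ ^ 2) = 1 / γ by field_simp] at h2
    exact hm.trans h2
  classical
  have hex' : ∃ k : ℕ, m ≤ γ * 2 ^ k := ⟨_, hex⟩
  refine ⟨Nat.find hex', Nat.lt_succ_of_le (Nat.find_min' hex' hex), Nat.find_spec hex', ?_⟩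
  rcases hk : Nat.find hex' with _ | k
  · have := div_nonneg hm0 hγ.le
    rw [pow_zero]; linarith
  · have h1 := Nat.find_min hex' (m := k) (by omega)
    have h2 : (2 : ℝ) ^ k ≤ m / γ := by
      rw [le_div_iff₀ hγ]; linarith
    rw [pow_succ]; linarith

lemma log_card_scales_div_le {γ δ x : ℝ} (hγ : 0 < γ) (hγhalf : γ ≤ 1 / 2) (hδ : 0 < δ)
    (hδ1 : δ < 1) (hx : 1 / (γ * δ) ≤ x) :
    Real.log (1 / (δ / ((⌈1 / γ ^ 2⌉₊ + 1 : ℕ) : ℝ))) ≤ 3 * Real.log x := by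
  have hg : 2 ≤ 1 / γ := by rw [le_div_iff₀ hγ]; linarith
  have hd : 1 ≤ 1 / δ := by rw [le_div_iff₀ hδ]; linarith
  have hN : ((⌈1 / γ ^ 2⌉₊ + 1 : ℕ) : ℝ) ≤ (1 / γ) ^ 3 := by
    have h1 := (Nat.ceil_lt_add_one (a := 1 / γ ^ 2) (by positivity)).le
    have h2 : 1 / γ ^ 2 = (1 / γ) ^ 2 := by rw [div_pow, one_pow]
    push_cast
    rw [h2] at h1 ⊢
    nlinarith
  have hx' : 1 / γ * (1 / δ) ≤ x := by rwa [one_div_mul_one_div]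
  rw [← Real.log_rpow (lt_of_lt_of_le (by positivity) hx)]
  refine Real.log_le_log (by positivity) ?_
  rw [one_div_div]
  calc _ ≤ (1 / γ) ^ 3 / δ := div_le_div_of_nonneg_right hN hδ.le
    _ = (1 / γ) ^ 3 * (1 / δ) := by ring
    _ ≤ (1 / γ) ^ 3 * (1 / δ) ^ 3 :=
      mul_le_mul_of_nonneg_left (le_self_pow₀ hd (by norm_num)) (by positivity)
    _ = (1 / γ * (1 / δ)) ^ 3 := by ring
    _ ≤ x ^ 3 := pow_le_pow_left₀ (by positivity) hx' 3
    _ = x ^ (3 : ℝ) := by norm_cast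

/-- Absorption of all error terms into the logarithmic prefactor. -/
lemma error_terms_le {Λ η β γ T logK D S m V X Y P : ℝ} (hΛ : 1 ≤ Λ) (hη : 0 < η)
    (hγ : 0 < γ) (hT : 1 ≤ T) (hK : logK ≤ Λ) (hD : 1 / 2 ≤ D) (hS : 0 ≤ S) (hm : 0 ≤ m)
    (hV : 0 ≤ V) (hX : η * X ≤ 2 * (η * T) + 2 * D) (hP : P ≤ 1 + 2 * (m / γ))
    (hY : Y ≤ 2 * S + P * (3 * Λ)) :
    logK / η + 20 * (3 * η * (Y + 4 * T + 4 * X) + 12 * β ^ 2 * T) ≤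
      1000 * Λ * (1 / η + η * T + η * S + D + V + β ^ 2 * T + η / γ * m * D) := by
  have h1 : logK / η ≤ Λ * (1 / η) := by
    rw [mul_one_div]; exact div_le_div_of_nonneg_right hK hη.le
  have h2 : η * Y ≤ 2 * (η * S) + 3 * (Λ * η) + 6 * (Λ * (η / γ * m)) := by
    have h3 : P * (3 * Λ) ≤ (1 + 2 * (m / γ)) * (3 * Λ) :=
      mul_le_mul_of_nonneg_right hP (by linarith)
    have h4 := mul_le_mul_of_nonneg_left (hY.trans (add_le_add_right h3 _)) hη.le
    refine h4.trans_eq ?_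
    field_simp
    ring
  have hA : 0 ≤ η / γ * m := by positivity
  have e : ∀ z : ℝ, 0 ≤ z → z ≤ Λ * z := fun z hz => le_mul_of_one_le_left hz hΛ
  have hηT : 0 ≤ η * T := by positivity
  have hβT : 0 ≤ β ^ 2 * T := by positivity
  have hηS : 0 ≤ η * S := by positivity
  have a1 := e _ hηT
  have a2 := e _ hβT
  have a3 := e _ hηS
  have a4 := e D (by linarith)
  have a5 := e _ hV
  have a6 : Λ * (η / γ * m) ≤ 2 * (Λ * (η / γ * m * D)) := by
    have h3 : 0 ≤ Λ * (η / γ * m) := by positivity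
    nlinarith
  have a7 : Λ * η ≤ Λ * (η * T) :=
    mul_le_mul_of_nonneg_left (le_mul_of_one_le_right hη.le hT) (by linarith)
  have a8 : 0 ≤ Λ * (1 / η) := by positivity
  have a9 : 0 ≤ Λ * (η / γ * m * D) := by positivity
  linarith

/-- Bound on `Term6` (Lemma `term-6`): under the strongly observable graph algorithm with
`η ≤ 1/2`, `β ≤ 1/2`, `γ ∈ (0,1/2]`, for any fixed arm `j`, with
`Q_t = Σ_{i∈S_t} p_{t,i}/(W_{t,i}+γ)`, for a universal constant `C`, with probability at
least `1 − 2δ`,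
`Σ_t ⟨p_t − e_j, ℓ̂_t⟩ ≤ C log(KT/(γδ)) (1/η + ηT + η Σ_t Q_t + log(1/δ) + √(ηT) + β²T +
(η/γ)(max_t Q_t) log(1/δ)) − β Σ_t (p_{t,j_t}/W_{t,j_t}) 1{t∈𝒯} +
β Σ_t 1{t∈𝒯, j = j_t}/W_{t,j_t}`. -/
theorem stmt_6 :
    ∃ C : ℝ, 0 < C ∧
    ∀ (Ω : Type) (mΩ : MeasurableSpace Ω) (μ : Measure Ω)
      (hμ : IsProbabilityMeasure μ)
      (ℱ : ℕ → MeasurableSpace Ω) (hℱle : ∀ t, ℱ t ≤ mΩ) (hℱmono : Monotone ℱ)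
      (K T : ℕ) (hK : 2 ≤ K) (hT : 1 ≤ T)
      (ℓ : ℕ → Ω → Fin K → ℝ)
      (hℓmem : ∀ t ω i, ℓ t ω i ∈ Set.Icc (0 : ℝ) 1)
      (hℓmeas : ∀ t, 1 ≤ t → t ≤ T → ∀ i, Measurable[ℱ (t - 1)] fun ω => ℓ t ω i)
      (Nin : ℕ → Ω → Fin K → Finset (Fin K))
      (hNmeas : ∀ t, 1 ≤ t → t ≤ T → ∀ i j,
        MeasurableSet[ℱ (t - 1)] {ω | j ∈ Nin t ω i})
      -- the graphs are strongly observable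
      (hstrong : ∀ t, 1 ≤ t → t ≤ T → ∀ ω i,
        i ∈ Nin t ω i ∨ Nin t ω i = Finset.univ.erase i)
      -- parameters
      (η β γ : ℝ) (hη0 : 0 < η) (hηhalf : η ≤ 1 / 2)
      (hβ0 : 0 < β) (hβhalf : β ≤ 1 / 2) (hγ0 : 0 < γ) (hγhalf : γ ≤ 1 / 2)
      -- the OMD iterates and the sampling distributions
      (p : ℕ → Ω → Fin K → ℝ)
      (hpmeas : ∀ t, 1 ≤ t → t ≤ T → ∀ i, Measurable[ℱ (t - 1)] fun ω => p t ω i)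
      (hpnn : ∀ t ω i, 0 ≤ p t ω i) (hpsum : ∀ t ω, ∑ i, p t ω i = 1)
      (hp1 : ∀ ω i, p 1 ω i = 1 / K)
      (ptil : ℕ → Ω → Fin K → ℝ)
      (hptil : ∀ t ω i, ptil t ω i = (1 - η) * p t ω i + η / K)
      (I : ℕ → Ω → Fin K)
      (hImeas : ∀ t, 1 ≤ t → t ≤ T → Measurable[ℱ t] (I t))
      (hIlaw : ∀ t, 1 ≤ t → t ≤ T → ∀ i,
        (μ[fun ω => Set.indicator {ω' | I t ω' = i} (fun _ => (1 : ℝ)) ω | ℱ (t - 1)])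
          =ᵐ[μ] fun ω => ptil t ω i)
      (W : ℕ → Ω → Fin K → ℝ)
      (hW : ∀ t ω i, W t ω i = ∑ j ∈ Nin t ω i, ptil t ω j)
      -- implicit-exploration estimator on self-loop nodes, unbiased estimator otherwise
      (ℓhat : ℕ → Ω → Fin K → ℝ)
      (hℓhat : ∀ t ω i, ℓhat t ω i =
        if i ∈ Nin t ω i then
          (if I t ω ∈ Nin t ω i then ℓ t ω i / (W t ω i + γ) else 0)
        else (if I t ω ≠ i then ℓ t ω i / W t ω i else 0))
      -- rounds in `𝒯` and the distinguished node `j_t`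
      (inT : ℕ → Ω → Prop) (jt : ℕ → Ω → Fin K)
      (hinT : ∀ t ω, inT t ω ↔ ∃ j : Fin K, j ∉ Nin t ω j ∧ 1 / 2 < p t ω j)
      (hjt : ∀ t ω, inT t ω → jt t ω ∉ Nin t ω (jt t ω) ∧ 1 / 2 < p t ω (jt t ω))
      -- the positive bias vector
      (b : ℕ → Ω → Fin K → ℝ)
      (hb1 : ∀ t ω, inT t ω → b t ω (jt t ω) = β / W t ω (jt t ω))
      (hb2 : ∀ t ω i, ¬inT t ω ∨ i ≠ jt t ω → b t ω i = 0)
      -- the OMD update with the entropy regularizer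
      (Dψ : (Fin K → ℝ) → (Fin K → ℝ) → ℝ)
      (hD : ∀ x y, Dψ x y = (1 / η) * ∑ i, (x i * Real.log (x i / y i) + y i - x i))
      (hupdate : ∀ t, 1 ≤ t → t ≤ T → ∀ ω,
        (∀ i, 0 ≤ p (t + 1) ω i) ∧ (∑ i, p (t + 1) ω i = 1) ∧
          ∀ q : Fin K → ℝ, (∀ i, 0 ≤ q i) → (∑ i, q i = 1) →
            (∑ i, p (t + 1) ω i * (ℓhat t ω i + b t ω i)) + Dψ (p (t + 1) ω) (p t ω) ≤
              (∑ i, q i * (ℓhat t ω i + b t ω i)) + Dψ q (p t ω))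
      (j : Fin K)
      (Q : ℕ → Ω → ℝ)
      (hQ : ∀ t ω, Q t ω = ∑ i ∈ Finset.univ.filter (fun i => i ∈ Nin t ω i),
        p t ω i / (W t ω i + γ))
      (δ : ℝ) (hδ0 : 0 < δ) (hδ1 : δ < 1),
      ENNReal.ofReal (1 - 2 * δ) ≤
        μ {ω | ∑ t ∈ Finset.Icc 1 T,
            ∑ i, (p t ω i - (if i = j then (1 : ℝ) else 0)) * ℓhat t ω i ≤
          C * Real.log ((K : ℝ) * T / (γ * δ)) *
            (1 / η + η * T + η * (∑ t ∈ Finset.Icc 1 T, Q t ω) + Real.log (1 / δ) +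
              Real.sqrt (η * T) + β ^ 2 * T +
              (η / γ) *
                ((Finset.Icc 1 T).sup' (Finset.nonempty_Icc.mpr hT) fun t => Q t ω) *
                Real.log (1 / δ)) -
          β * (∑ t ∈ Finset.Icc 1 T,
            Set.indicator {t' | inT t' ω}
              (fun t' => p t' ω (jt t' ω) / W t' ω (jt t' ω)) t) +
          β * (∑ t ∈ Finset.Icc 1 T,
            Set.indicator {t' | inT t' ω ∧ j = jt t' ω}
              (fun t' => 1 / W t' ω (jt t' ω)) t)} := by
  refine ⟨1000, by norm_num, ?_⟩
  intro Ω mΩ μ hμ ℱ hℱle hℱmono K T hK hT ℓ hℓmem hℓmeas Nin hNmeas hstrong η β γ hη0 hηhalf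
    hβ0 hβhalf hγ0 hγhalf p hpmeas hpnn hpsum hp1 ptil hptil I hImeas hIlaw W hW ℓhat hℓhat
    inT jt hinT hjt b hb1 hb2 Dψ hD hupdate j Q hQ δ hδ0 hδ1
  rcases le_or_gt (1 / 2) δ with hδ | hδ
  · rw [ENNReal.ofReal_of_nonpos (by linarith)]
    exact zero_le
  classical
  have hq0 : ∀ t ω i, 0 ≤ ptil t ω i := fun t ω =>
    mixed_nonneg hη0 hηhalf (hpnn t ω) (hptil t ω)
  have hq1 : ∀ t ω, ∑ i, ptil t ω i = 1 := fun t ω => mixed_sum hK (hpsum t ω) (hptil t ω)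
  have hW0 : ∀ t ω i, 0 ≤ W t ω i := fun t ω i => by
    rw [hW]; exact Finset.sum_nonneg fun k _ => hq0 t ω k
  have hWlow : ∀ t, 1 ≤ t → t ≤ T → ∀ ω i, i ∉ Nin t ω i →
      (1 - η) * (1 - p t ω i) + η / 2 ≤ W t ω i := fun t h1 h2 ω i hi =>
    observation_loopFree hK hη0 (hpsum t ω) (hptil t ω) (hW t ω) (hstrong t h1 h2 ω i) hi
  have hp1' : ∀ t ω i, p t ω i ≤ 1 := fun t ω i =>
    (Finset.single_le_sum (fun i _ => hpnn t ω i) (Finset.mem_univ i)).trans_eq (hpsum t ω)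
  have hWη : ∀ t, 1 ≤ t → t ≤ T → ∀ ω i, i ∉ Nin t ω i → η / 2 ≤ W t ω i :=
    fun t h1 h2 ω i hi => by
      have := hWlow t h1 h2 ω i hi
      have : 0 ≤ (1 - η) * (1 - p t ω i) :=
        mul_nonneg (by linarith) (by linarith [hp1' t ω i])
      linarith
  have hQ0 : ∀ t ω, 0 ≤ Q t ω := fun t ω => by
    rw [hQ]
    refine Finset.sum_nonneg fun i _ => ?_
    have := hpnn t ω i
    have := hW0 t ω i
    positivity
  have hQγ : ∀ t ω, Q t ω ≤ 1 / γ := fun t ω => by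
    rw [hQ, ← hpsum t ω, Finset.sum_div]
    refine (Finset.sum_le_sum_of_subset_of_nonneg (Finset.filter_subset _ _) fun i _ _ => ?_).trans
      (Finset.sum_le_sum fun i _ => ?_)
    · have := hpnn t ω i
      have := hW0 t ω i
      positivity
    · exact div_le_div_of_nonneg_left (hpnn t ω i) hγ0 (by linarith [hW0 t ω i])
  have hqm : ∀ t, 1 ≤ t → t ≤ T → ∀ i, Measurable[ℱ (t - 1)] fun ω => ptil t ω i :=
    fun t h1 h2 i => by
      simp only [hptil]
      exact ((hpmeas t h1 h2 i).const_mul _).add_const _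
  have hWm : ∀ t, 1 ≤ t → t ≤ T → ∀ i, Measurable[ℱ (t - 1)] fun ω => W t ω i :=
    fun t h1 h2 i => by
      have : (fun ω => W t ω i) = fun ω => ∑ k, if k ∈ Nin t ω i then ptil t ω k else 0 := by
        funext ω
        rw [hW, Finset.sum_ite_mem, Finset.univ_inter]
      rw [this]
      exact Finset.measurable_sum _ fun k _ =>
        Measurable.ite (hNmeas t h1 h2 i k) (hqm t h1 h2 k) measurable_const
  have hQm : ∀ t, 1 ≤ t → t ≤ T → Measurable[ℱ (t - 1)] fun ω => Q t ω :=
    fun t h1 h2 => by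
      simp only [hQ, Finset.sum_filter]
      exact Finset.measurable_sum _ fun i _ => Measurable.ite (hNmeas t h1 h2 i i)
        ((hpmeas t h1 h2 i).div ((hWm t h1 h2 i).add_const _)) measurable_const
  have hXm : ∀ t, 1 ≤ t → t ≤ T → ∀ a,
      Measurable[ℱ (t - 1)] fun ω => loopFreeVar (Nin t ω) (p t ω) (W t ω) a :=
    fun t h1 h2 a => by
      refine Finset.measurable_sum _ fun i _ => Measurable.ite ?_
        ((hpmeas t h1 h2 i).div (hWm t h1 h2 i)) measurable_const
      exact (hNmeas t h1 h2 i i).compl.inter (MeasurableSet.const _)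
  have hYm : ∀ t, 1 ≤ t → t ≤ T → ∀ a,
      Measurable[ℱ (t - 1)] fun ω => selfLoopVar (Nin t ω) (p t ω) (W t ω) γ a :=
    fun t h1 h2 a => by
      refine Finset.measurable_sum _ fun i _ => Measurable.ite ?_
        ((hpmeas t h1 h2 i).div (((hWm t h1 h2 i).add_const _).pow_const 2)) measurable_const
      exact (hNmeas t h1 h2 i i).inter (hNmeas t h1 h2 i a)
  have hY0 : ∀ t ω a, 0 ≤ selfLoopVar (Nin t ω) (p t ω) (W t ω) γ a := fun t ω a =>
    selfLoopVar_nonneg (hpnn t ω) a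
  have hX0 : ∀ t ω a, 0 ≤ loopFreeVar (Nin t ω) (p t ω) (W t ω) a := fun t ω a =>
    loopFreeVar_nonneg (hpnn t ω) (hW0 t ω) a
  have hNpos : (0 : ℝ) < ((⌈1 / γ ^ 2⌉₊ + 1 : ℕ) : ℝ) := by positivity
  refine ofReal_one_sub_two_mul_le_measure hδ0 (Nat.succ_pos ⌈1 / γ ^ 2⌉₊)
    (measure_log_lt_sum_sub_le hℱle hℱmono hImeas hqm hq0 hq1 hIlaw
      (f := fun t ω a => η / 2 * loopFreeVar (Nin t ω) (p t ω) (W t ω) a)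
      (fun t h1 h2 a => (hXm t h1 h2 a).const_mul _)
      (fun t h1 h2 ω a => mul_nonneg (by positivity) (hX0 t ω a))
      (fun t h1 h2 ω a => loopFreeVar_le hη0 (hpnn t ω) (hpsum t ω) (hWη t h1 h2 ω) a) hδ0)
    (fun k _ => measure_log_lt_sum_sub_le hℱle hℱmono hImeas hqm hq0 hq1 hIlaw
      (f := fun t ω a => if Q t ω ≤ γ * 2 ^ k then
        selfLoopVar (Nin t ω) (p t ω) (W t ω) γ a / 2 ^ k else 0)
      (fun t h1 h2 a => Measurable.ite (measurableSet_le (hQm t h1 h2) measurable_const)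
        ((hYm t h1 h2 a).div_const _) measurable_const)
      (fun t h1 h2 ω a => ?_) (fun t h1 h2 ω a => ?_) (div_pos hδ0 hNpos)) ?_
  · have := hY0 t ω a
    split_ifs <;> positivity
  · split_ifs with h
    · rw [div_le_one (by positivity)]
      refine (selfLoopVar_le hγ0 (hpnn t ω) (hW0 t ω) a).trans ?_
      rw [← hQ, div_le_iff₀ hγ0, mul_comm]
      exact h
    · exact zero_le_one
  intro ω hω1 hω2
  simp only [Set.mem_ofPred_eq, not_lt] at hω1 hω2 ⊢
  set m := (Finset.Icc 1 T).sup' (Finset.nonempty_Icc.mpr hT) fun t => Q t ω with hm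
  have hQm' : ∀ t ∈ Finset.Icc 1 T, Q t ω ≤ m := fun t ht =>
    Finset.le_sup' (fun t => Q t ω) ht
  have hm0 : 0 ≤ m := (hQ0 1 ω).trans (hQm' 1 (Finset.mem_Icc.mpr ⟨le_rfl, hT⟩))
  have hmγ : m ≤ 1 / γ := Finset.sup'_le _ _ fun t _ => hQγ t ω
  obtain ⟨k, hkN, hmk, hk⟩ := exists_dyadic_scale hγ0 hm0 hmγ
  have hTR : (1 : ℝ) ≤ T := by exact_mod_cast hT
  have hKR : (2 : ℝ) ≤ K := by exact_mod_cast hK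
  have hKT : (2 : ℝ) ≤ K * T := by nlinarith
  have hγδ : 0 < γ * δ := mul_pos hγ0 hδ0
  have hγδ4 : γ * δ ≤ 1 / 4 := by nlinarith
  have hΛ1 : 1 ≤ Real.log ((K : ℝ) * T / (γ * δ)) := by
    rw [Real.le_log_iff_exp_le (by positivity)]
    refine Real.exp_one_lt_d9.le.trans ?_
    rw [le_div_iff₀ hγδ]
    nlinarith
  have hlogK : Real.log K ≤ Real.log ((K : ℝ) * T / (γ * δ)) := by
    refine Real.log_le_log (by positivity) ?_
    rw [le_div_iff₀ hγδ]
    nlinarith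
  have hlogδ : 1 / 2 ≤ Real.log (1 / δ) := by
    have h1 : Real.log 2 ≤ Real.log (1 / δ) :=
      Real.log_le_log two_pos (by rw [le_div_iff₀ hδ0]; linarith)
    linarith [Real.log_two_gt_d9]
  have hXsum : η * ∑ t ∈ Finset.Icc 1 T, loopFreeVar (Nin t ω) (p t ω) (W t ω) (I t ω) ≤
      2 * (η * T) + 2 * Real.log (1 / δ) := by
    have h1 : ∑ t ∈ Finset.Icc 1 T,
        (η / 2 * loopFreeVar (Nin t ω) (p t ω) (W t ω) (I t ω) - η) ≤ Real.log (1 / δ) := by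
      refine (Finset.sum_le_sum fun t ht => ?_).trans hω1
      obtain ⟨h1, h2⟩ := Finset.mem_Icc.mp ht
      have h3 := sum_mul_loopFreeVar_le (hpnn t ω) (hpsum t ω)
        (fun i hi => lt_of_lt_of_le (by positivity) (hWη t h1 h2 ω i hi)) (hstrong t h1 h2 ω)
        (hW t ω)
      have h4 : ∑ i, ptil t ω i * (η / 2 * loopFreeVar (Nin t ω) (p t ω) (W t ω) i) =
          η / 2 * ∑ i, ptil t ω i * loopFreeVar (Nin t ω) (p t ω) (W t ω) i := by
        rw [Finset.mul_sum]
        exact Finset.sum_congr rfl fun i _ => by ring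
      rw [h4]
      nlinarith
    simp only [Finset.sum_sub_distrib, Finset.sum_const, Nat.card_Icc, nsmul_eq_mul,
      ← Finset.mul_sum, Nat.add_sub_cancel] at h1
    linarith
  have hYsum : ∑ t ∈ Finset.Icc 1 T, selfLoopVar (Nin t ω) (p t ω) (W t ω) γ (I t ω) ≤
      2 * ∑ t ∈ Finset.Icc 1 T, Q t ω +
        2 ^ k * (3 * Real.log ((K : ℝ) * T / (γ * δ))) := by
    have h1 : ∑ t ∈ Finset.Icc 1 T, (selfLoopVar (Nin t ω) (p t ω) (W t ω) γ (I t ω) / 2 ^ k -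
        2 * (Q t ω / 2 ^ k)) ≤ 3 * Real.log ((K : ℝ) * T / (γ * δ)) := by
      refine ((Finset.sum_le_sum fun t ht => ?_).trans (hω2 k hkN)).trans
        (log_card_scales_div_le hγ0 hγhalf hδ0 hδ1
          (div_le_div_of_nonneg_right (by linarith) hγδ.le))
      simp only [if_pos ((hQm' t ht).trans hmk)]
      have h3 := sum_mul_selfLoopVar_le hγ0 (hpnn t ω) (hW0 t ω) (hW t ω)
      rw [← hQ] at h3
      have h4 := div_le_div_of_nonneg_right h3 (show (0 : ℝ) ≤ 2 ^ k by positivity)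
      rw [Finset.sum_div] at h4
      simp only [mul_div_assoc] at h4
      linarith
    rw [Finset.sum_sub_distrib, ← Finset.mul_sum, ← Finset.sum_div, ← Finset.sum_div] at h1
    have h2 := mul_le_mul_of_nonneg_left h1 (show (0 : ℝ) ≤ 2 ^ k by positivity)
    have h5 : (2 : ℝ) ^ k ≠ 0 := by positivity
    rw [mul_sub, mul_div_cancel₀ _ h5, mul_left_comm, mul_div_cancel₀ _ h5] at h2
    linarith
  have hround : ∀ t, ∃ c, 1 ≤ t → t ≤ T → (∀ i, -3 ≤ η * (ℓhat t ω i + b t ω i - c)) ∧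
      η * ∑ i, p t ω i * (ℓhat t ω i + b t ω i - c) ^ 2 ≤
        3 * η * (selfLoopVar (Nin t ω) (p t ω) (W t ω) γ (I t ω) + 4 +
          4 * loopFreeVar (Nin t ω) (p t ω) (W t ω) (I t ω)) + 12 * β ^ 2 := by
    intro t
    by_cases ht : 1 ≤ t ∧ t ≤ T
    · obtain ⟨c, hc⟩ := exists_shift_second_moment_le hη0 hηhalf hβ0 hβhalf hγ0 (hℓmem t ω)
        (hpnn t ω) (hpsum t ω) (hW0 t ω) (hWlow t ht.1 ht.2 ω) (I t ω) (hℓhat t ω)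
        (b := b t ω) (by
          by_cases h : inT t ω
          · exact Or.inl ⟨jt t ω, (hjt t ω h).1, (hjt t ω h).2, hb1 t ω h,
              fun i hi => hb2 t ω i (Or.inr hi)⟩
          · refine Or.inr ⟨fun i hi => ?_, fun i => hb2 t ω i (Or.inl h)⟩
            by_contra h'
            exact h ((hinT t ω).mpr ⟨i, hi, not_le.mp h'⟩))
      exact ⟨c, fun _ _ => hc⟩
    · exact ⟨0, fun h1 h2 => absurd ⟨h1, h2⟩ ht⟩
  choose c hc using hround
  have hreg := multiplicative_weights_regret hη0 T (p := fun t => p t ω)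
    (L := fun t i => ℓhat t ω i + b t ω i) (c := c)
    (fun i => by rw [hp1, Fintype.card_fin]) (fun t => hpsum t ω) (fun t => hpnn t ω)
    (fun t h1 h2 hpos i => by
      obtain ⟨u1, u2, u3⟩ := hupdate t h1 h2 ω
      refine entropic_step_eq (L := fun i => ℓhat t ω i + b t ω i) hη0 hpos (hpsum t ω) u1 u2
        (fun q v1 v2 => ?_) i
      have := u3 q v1 v2
      rwa [hD, hD] at this)
    (fun t h1 h2 => (hc t h1 h2).1) j
  rw [Fintype.card_fin] at hreg
  have hsecond : η * ∑ t ∈ Finset.Icc 1 T, ∑ i, p t ω i * (ℓhat t ω i + b t ω i - c t) ^ 2 ≤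
      3 * η * (∑ t ∈ Finset.Icc 1 T, selfLoopVar (Nin t ω) (p t ω) (W t ω) γ (I t ω) + 4 * T +
        4 * ∑ t ∈ Finset.Icc 1 T, loopFreeVar (Nin t ω) (p t ω) (W t ω) (I t ω)) +
        12 * β ^ 2 * T := by
    rw [Finset.mul_sum]
    refine (Finset.sum_le_sum fun t ht =>
      (hc t (Finset.mem_Icc.mp ht).1 (Finset.mem_Icc.mp ht).2).2).trans_eq ?_
    simp only [Finset.sum_add_distrib, ← Finset.mul_sum, Finset.sum_const, Nat.card_Icc,
      nsmul_eq_mul, Nat.add_sub_cancel]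
    ring
  have hbias : ∀ t, ∑ i, (p t ω i - (if i = j then (1 : ℝ) else 0)) * b t ω i =
      β * Set.indicator {t' | inT t' ω} (fun t' => p t' ω (jt t' ω) / W t' ω (jt t' ω)) t -
      β * Set.indicator {t' | inT t' ω ∧ j = jt t' ω} (fun t' => 1 / W t' ω (jt t' ω)) t := by
    intro t
    simp only [Set.indicator_apply, Set.mem_ofPred_eq]
    by_cases h : inT t ω
    · rw [Finset.sum_eq_single (jt t ω)
        (fun i _ hi => by rw [hb2 t ω i (Or.inr hi), mul_zero]) (by simp), hb1 t ω h]
      simp only [h, true_and, if_true, eq_comm (a := j)]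
      split_ifs <;> ring
    · simp [h, hb2 t ω _ (Or.inl h)]
  have hdecomp : ∑ t ∈ Finset.Icc 1 T,
      ∑ i, (p t ω i - (if i = j then (1 : ℝ) else 0)) * (ℓhat t ω i + b t ω i) =
      ∑ t ∈ Finset.Icc 1 T, ∑ i, (p t ω i - (if i = j then (1 : ℝ) else 0)) * ℓhat t ω i +
      (β * (∑ t ∈ Finset.Icc 1 T, Set.indicator {t' | inT t' ω}
        (fun t' => p t' ω (jt t' ω) / W t' ω (jt t' ω)) t) -
      β * (∑ t ∈ Finset.Icc 1 T, Set.indicator {t' | inT t' ω ∧ j = jt t' ω}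
        (fun t' => 1 / W t' ω (jt t' ω)) t)) := by
    simp only [mul_add, Finset.sum_add_distrib, hbias, Finset.sum_sub_distrib, ← Finset.mul_sum]
  have herr := error_terms_le (β := β) hΛ1 hη0 hγ0 hTR hlogK hlogδ
    (Finset.sum_nonneg fun t _ => hQ0 t ω : 0 ≤ ∑ t ∈ Finset.Icc 1 T, Q t ω) hm0
    (Real.sqrt_nonneg (η * T)) hXsum hk hYsum
  linarith
end
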